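/- Fix c > 1, η > 0, a positive integer r, and an invertible r×r diagonal matrix Σ with positive diagonal entries. For each N, let d = d(N) satisfy d(N)/N → c, let A_N be a d×N random matrix with i.i.d. Gaussian entries of mean 0 and variance η²/d, let U_N be a d×r matrix with U_N^T U_N = I_r, and let V_N be an N×r matrix with V_N^T V_N = I_r. With H_N = V_N^T A_N^†, Z_N = I_r + V_N^T A_N^† U_N Σ, P_N = −(I_d − A_N A_N^†) U_N Σ, and K_1^{(N)} = H_N H_N^T + Z_N (P_N^T P_N)^{-1} Z_N^T, one has lim_{N→∞} E[(K_1^{(N)})^{-1}] = η² (1 − 1/c) (η² Σ^{-2} + I_r)^{-1}. -/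

import Mathlib

open MeasureTheory ProbabilityTheory Matrix Filter

instance matrixMeasurableSpace {m n α : Type*} [MeasurableSpace α] :
    MeasurableSpace (Matrix m n α) :=
  inferInstanceAs (MeasurableSpace (m → n → α))

/-- The law of a `d × N` random matrix with i.i.d. real Gaussian entries of mean `0`
and variance `v`. -/
noncomputable def gaussMatrix (d N : ℕ) (v : NNReal) : Measure (Matrix (Fin d) (Fin N) ℝ) :=
  Measure.pi fun _ : Fin d => Measure.pi fun _ : Fin N => gaussianReal 0 v

/-- The Moore–Penrose pseudoinverse `A† = (AᵀA)⁻¹Aᵀ` of a full-column-rank matrix. -/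
noncomputable def pinv {d N : ℕ} (A : Matrix (Fin d) (Fin N) ℝ) : Matrix (Fin N) (Fin d) ℝ :=
  (Aᵀ * A)⁻¹ * Aᵀ

/-- The matrix `P = -(I - A A†) U Σ`. -/
noncomputable def Pmat {d N r : ℕ} (A : Matrix (Fin d) (Fin N) ℝ)
    (U : Matrix (Fin d) (Fin r) ℝ) (S : Matrix (Fin r) (Fin r) ℝ) :
    Matrix (Fin d) (Fin r) ℝ :=
  -((1 : Matrix (Fin d) (Fin d) ℝ) - A * pinv A) * U * S

/-- The matrix `H = Vᵀ A†`. -/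
noncomputable def Hmat {d N r : ℕ} (A : Matrix (Fin d) (Fin N) ℝ)
    (V : Matrix (Fin N) (Fin r) ℝ) : Matrix (Fin r) (Fin d) ℝ :=
  Vᵀ * pinv A

/-- The matrix `Z = I_r + Vᵀ A† U Σ`. -/
noncomputable def Zmat {d N r : ℕ} (A : Matrix (Fin d) (Fin N) ℝ)
    (U : Matrix (Fin d) (Fin r) ℝ) (V : Matrix (Fin N) (Fin r) ℝ)
    (S : Matrix (Fin r) (Fin r) ℝ) : Matrix (Fin r) (Fin r) ℝ :=
  1 + Vᵀ * pinv A * U * S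

/-- The matrix `K₁ = H Hᵀ + Z (PᵀP)⁻¹ Zᵀ`. -/
noncomputable def K1mat {d N r : ℕ} (A : Matrix (Fin d) (Fin N) ℝ)
    (U : Matrix (Fin d) (Fin r) ℝ) (V : Matrix (Fin N) (Fin r) ℝ)
    (S : Matrix (Fin r) (Fin r) ℝ) : Matrix (Fin r) (Fin r) ℝ :=
  Hmat A V * (Hmat A V)ᵀ +
    Zmat A U V S * ((Pmat A U S)ᵀ * Pmat A U S)⁻¹ * (Zmat A U V S)ᵀ

/-- The law of a vector with i.i.d. centered Gaussian entries of variance `v`. -/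
noncomputable def gaussVec (n : ℕ) (v : NNReal) : Measure (Fin n → ℝ) :=
  Measure.pi fun _ : Fin n => gaussianReal 0 v

instance (n : ℕ) (v : NNReal) : IsProbabilityMeasure (gaussVec n v) := by
  unfold gaussVec; infer_instance

instance (d N : ℕ) (v : NNReal) : IsProbabilityMeasure (gaussMatrix d N v) :=
  inferInstanceAs (IsProbabilityMeasure
    (Measure.pi fun _ : Fin d => Measure.pi fun _ : Fin N => gaussianReal 0 v))

lemma gaussianReal_eq_map_sqrt_mul (v : NNReal) :
    gaussianReal 0 v = (gaussianReal 0 1).map (fun x => √(v : ℝ) * x) := by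
  rw [gaussianReal_map_const_mul]
  congr 1
  · simp
  · ext; simp

lemma gaussVec_eq_map_smul (n : ℕ) (v : NNReal) :
    gaussVec n v = (gaussVec n 1).map (fun x i => √(v : ℝ) * x i) := by
  unfold gaussVec
  rw [Measure.pi_map_pi (fun i => by fun_prop)]
  simp_rw [← gaussianReal_eq_map_sqrt_mul]

lemma measurable_mulVec {m n : ℕ} (M : Matrix (Fin m) (Fin n) ℝ) :
    Measurable (fun x : Fin n → ℝ => M *ᵥ x) := by
  refine Continuous.measurable ?_
  fun_prop

/-- The isometry of Euclidean space given by an orthogonal matrix. -/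
noncomputable def isometryOfOrthogonal {n : ℕ} (Q : Matrix (Fin n) (Fin n) ℝ) (hQ : Qᵀ * Q = 1) :
    EuclideanSpace ℝ (Fin n) ≃ₗᵢ[ℝ] EuclideanSpace ℝ (Fin n) :=
  LinearIsometry.toLinearIsometryEquiv
    { toLinearMap := Matrix.toEuclideanLin Q
      norm_map' := fun x => by
        have h : (Q *ᵥ x.ofLp) ⬝ᵥ (Q *ᵥ x.ofLp) = x.ofLp ⬝ᵥ x.ofLp := by
          rw [Matrix.dotProduct_mulVec, ← Matrix.mulVec_transpose, Matrix.mulVec_mulVec, hQ,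
            Matrix.one_mulVec]
        rw [EuclideanSpace.norm_eq, EuclideanSpace.norm_eq]
        congr 1
        simpa [dotProduct, ← pow_two] using h } rfl

lemma gaussVec_map_orthogonal {n : ℕ} (v : NNReal) (Q : Matrix (Fin n) (Fin n) ℝ)
    (hQ : Qᵀ * Q = 1) : MeasurePreserving (fun x => Q *ᵥ x) (gaussVec n v) (gaussVec n v) := by
  have h1 : (gaussVec n 1).map (fun x => Q *ᵥ x) = gaussVec n 1 := by
    have h := stdGaussian_map (isometryOfOrthogonal Q hQ)
    rw [← map_pi_eq_stdGaussian, Measure.map_map (by fun_prop) (by fun_prop)] at h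
    have h' := congrArg (Measure.map WithLp.ofLp) h
    rw [Measure.map_map (by fun_prop) (by fun_prop),
      Measure.map_map (by fun_prop) (by fun_prop)] at h'
    simpa [Function.comp_def, gaussVec, isometryOfOrthogonal] using h'
  refine ⟨measurable_mulVec Q, ?_⟩
  rw [gaussVec_eq_map_smul n v, Measure.map_map (measurable_mulVec Q) (by fun_prop)]
  conv_rhs => rw [← h1]
  rw [Measure.map_map (by fun_prop) (measurable_mulVec Q)]
  congr 1
  ext x i
  simp only [Function.comp_apply]
  exact congrFun (Matrix.mulVec_smul Q (√(v : ℝ)) x) i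

/-- Transposition preserves the law of a Gaussian matrix. -/
lemma gaussMatrix_transpose (d N : ℕ) (v : NNReal) :
    MeasurePreserving (fun A : Matrix (Fin d) (Fin N) ℝ => Aᵀ)
      (gaussMatrix d N v) (gaussMatrix N d v) := by
  have key : ∀ m n : ℕ, MeasurePreserving (MeasurableEquiv.curry (Fin m) (Fin n) ℝ)
      (Measure.pi fun _ : Fin m × Fin n => gaussianReal 0 v) (gaussMatrix m n v) := by
    intro m n
    refine ⟨(MeasurableEquiv.curry (Fin m) (Fin n) ℝ).measurable, ?_⟩
    have h := Measure.infinitePi_map_curry (fun (_ : Fin m) (_ : Fin n) => gaussianReal 0 v)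
    simp only [Measure.infinitePi_eq_pi] at h
    exact h
  have h1 := (key d N).symm
  have h2 := measurePreserving_piCongrLeft
    (fun _ : Fin N × Fin d => gaussianReal 0 v) (Equiv.prodComm (Fin d) (Fin N))
  have h3 := (key N d).comp (h2.comp h1)
  convert! h3 using 1

lemma gaussMatrix_mul_orthogonal {d N : ℕ} (v : NNReal) (Q : Matrix (Fin N) (Fin N) ℝ)
    (hQ : Q * Qᵀ = 1) :
    MeasurePreserving (fun A : Matrix (Fin d) (Fin N) ℝ => A * Q)
      (gaussMatrix d N v) (gaussMatrix d N v) := by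
  have h := measurePreserving_pi (fun _ : Fin d => gaussVec N v) (fun _ : Fin d => gaussVec N v)
    (f := fun _ x => Qᵀ *ᵥ x) (fun _ => gaussVec_map_orthogonal v Qᵀ (by simpa using hQ))
  convert! h using 1
  ext A i j
  simp [Matrix.mul_apply, Matrix.mulVec, dotProduct, mul_comm]

lemma gaussMatrix_orthogonal_mul {d N : ℕ} (v : NNReal) (Q : Matrix (Fin d) (Fin d) ℝ)
    (hQ : Qᵀ * Q = 1) :
    MeasurePreserving (fun A : Matrix (Fin d) (Fin N) ℝ => Q * A)
      (gaussMatrix d N v) (gaussMatrix d N v) := by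
  have h := (gaussMatrix_transpose N d v).comp ((gaussMatrix_mul_orthogonal v Qᵀ
    (by simpa using hQ)).comp (gaussMatrix_transpose d N v))
  convert! h using 1
  ext A i j
  simp [← Matrix.transpose_mul]

/-- A unit vector is the image of any other one under some orthogonal matrix. -/
lemma exists_orthogonal_mulVec {n : ℕ} (x y : Fin n → ℝ) (hxy : x ⬝ᵥ x = y ⬝ᵥ y) :
    ∃ Q : Matrix (Fin n) (Fin n) ℝ, Qᵀ * Q = 1 ∧ Q * Qᵀ = 1 ∧ Q *ᵥ x = y := by
  by_cases h : x = y
  · exact ⟨1, by simp, by simp, by simp [h]⟩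
  set w := x - y with hw
  have hw0 : w ⬝ᵥ w ≠ 0 := by
    rw [Ne, dotProduct_self_eq_zero]
    exact sub_ne_zero.mpr h
  set Q : Matrix (Fin n) (Fin n) ℝ := 1 - (2 / (w ⬝ᵥ w)) • Matrix.vecMulVec w w with hQ
  have hT : Qᵀ = Q := by
    rw [hQ]; ext i j
    simp [Matrix.vecMulVec_apply, Matrix.one_apply, eq_comm, mul_comm]
  have hsq : Q * Q = 1 := by
    have hv : Matrix.vecMulVec w w * Matrix.vecMulVec w w
        = (w ⬝ᵥ w) • Matrix.vecMulVec w w := by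
      ext i j
      simp only [Matrix.mul_apply, Matrix.vecMulVec_apply, Matrix.smul_apply, dotProduct,
        smul_eq_mul, Finset.sum_mul]
      exact Finset.sum_congr rfl fun k _ => by ring
    have hR : ((2 / (w ⬝ᵥ w)) • Matrix.vecMulVec w w) * ((2 / (w ⬝ᵥ w)) • Matrix.vecMulVec w w)
        = (2 / (w ⬝ᵥ w)) • Matrix.vecMulVec w w + (2 / (w ⬝ᵥ w)) • Matrix.vecMulVec w w := by
      rw [Matrix.smul_mul, Matrix.mul_smul, hv, smul_smul, smul_smul, ← add_smul]
      congr 1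
      field_simp; norm_num
    rw [hQ, sub_mul, one_mul, mul_sub, hR, mul_one]; abel
  refine ⟨Q, by rw [hT, hsq], by rw [hT, hsq], ?_⟩
  have h2 : w ⬝ᵥ w = 2 * (w ⬝ᵥ x) := by
    have : x ⬝ᵥ y = y ⬝ᵥ x := dotProduct_comm _ _
    simp only [hw, dotProduct_sub, sub_dotProduct]
    linarith
  have h3 : Q *ᵥ x = x - (2 / (w ⬝ᵥ w) * (w ⬝ᵥ x)) • w := by
    rw [hQ, Matrix.sub_mulVec, Matrix.one_mulVec, Matrix.smul_mulVec, Matrix.vecMulVec_mulVec]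
    simp [smul_smul]
  have h4 : 2 / (w ⬝ᵥ w) * (w ⬝ᵥ x) = 1 := by
    rw [div_mul_eq_mul_div, ← h2, div_self hw0]
  rw [h3, h4, one_smul, hw]; abel

/-- The variance of the square of a standard Gaussian variable. -/
noncomputable def gaussSqVar : ℝ := Var[fun x : ℝ => x ^ 2; gaussianReal 0 1]

lemma gaussSqVar_nonneg : 0 ≤ gaussSqVar := variance_nonneg _ _

lemma integral_sq_gaussianReal (v : NNReal) : ∫ x, x ^ 2 ∂(gaussianReal 0 v) = v := by
  have h := variance_eq_sub (memLp_id_gaussianReal' (μ := 0) (v := v) 2 (by simp))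
  rw [variance_id_gaussianReal] at h
  simpa using h.symm

lemma memLp_sq_gaussianReal (v : NNReal) :
    MemLp (fun x : ℝ => x ^ 2) 2 (gaussianReal 0 v) := by
  have h := memLp_id_gaussianReal' (μ := 0) (v := v) 4 (by simp)
  rw [memLp_two_iff_integrable_sq (by fun_prop)]
  have h' := h.integrable_norm_pow (by norm_num)
  refine h'.congr (Eventually.of_forall fun x => ?_)
  have h2 : ‖x‖ ^ 2 = x ^ 2 := by simp
  have : ‖x‖ ^ 4 = (x ^ 2) ^ 2 := by rw [← h2]; ring
  simpa using this

lemma variance_sq_gaussianReal (v : NNReal) :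
    Var[fun x : ℝ => x ^ 2; gaussianReal 0 v] = gaussSqVar * v ^ 2 := by
  rw [gaussianReal_eq_map_sqrt_mul v, variance_map (by fun_prop) (by fun_prop)]
  have : ((fun x : ℝ => x ^ 2) ∘ fun x => √(v : ℝ) * x) = fun x => (v : ℝ) * x ^ 2 := by
    ext x
    simp [mul_pow]
  rw [this, variance_const_mul, gaussSqVar]; ring

lemma lintegral_sum_sub_sq {n : ℕ} (v : NNReal) (f : ℝ → ℝ) (hf : Measurable f)
    (hf2 : MemLp f 2 (gaussianReal 0 v)) (a : Fin n → ℝ) :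
    ∫⁻ g, ENNReal.ofReal ((∑ i, a i * f (g i)
        - (∫ x, f x ∂(gaussianReal 0 v)) * ∑ i, a i) ^ 2) ∂(gaussVec n v)
      = ENNReal.ofReal (Var[f; gaussianReal 0 v] * ∑ i, a i ^ 2) := by
  have hmp : ∀ i : Fin n, MeasurePreserving (Function.eval i) (gaussVec n v) (gaussianReal 0 v) :=
    fun i => measurePreserving_eval (fun _ : Fin n => gaussianReal 0 v) i
  have hL : ∀ i : Fin n, MemLp (fun g : Fin n → ℝ => f (g i)) 2 (gaussVec n v) :=
    fun i => hf2.comp_measurePreserving (hmp i)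
  have hL' : ∀ i : Fin n, MemLp (fun g : Fin n → ℝ => a i * f (g i)) 2 (gaussVec n v) :=
    fun i => (hL i).const_mul _
  have hmean : ∫ g, (∑ i, a i * f (g i)) ∂(gaussVec n v)
      = (∫ x, f x ∂(gaussianReal 0 v)) * ∑ i, a i := by
    rw [integral_finsetSum _ fun i _ => (hL' i).integrable (by norm_num), Finset.mul_sum]
    refine Finset.sum_congr rfl fun i _ => ?_
    rw [integral_const_mul, mul_comm]
    congr 1
    rw [← (hmp i).map_eq, integral_map (hmp i).measurable.aemeasurable
      (hf.aestronglyMeasurable)]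
  have hvar : Var[fun g => ∑ i, a i * f (g i); gaussVec n v]
      = Var[f; gaussianReal 0 v] * ∑ i, a i ^ 2 := by
    have h := IndepFun.variance_sum (μ := gaussVec n v) (s := Finset.univ)
      (X := fun (i : Fin n) (g : Fin n → ℝ) => a i * f (g i)) (fun i _ => hL' i) (by
        intro i _ j _ hij
        have := iIndepFun_pi (μ := fun _ : Fin n => gaussianReal 0 v)
          (X := fun (i : Fin n) x => a i * f x) (fun i => (hf.const_mul _).aemeasurable)
        exact this.indepFun hij)
    have e : (∑ i : Fin n, fun g : Fin n → ℝ => a i * f (g i)) = fun g => ∑ i, a i * f (g i) := by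
      ext g; simp
    rw [e] at h
    rw [h, Finset.mul_sum]
    refine Finset.sum_congr rfl fun i _ => ?_
    rw [variance_const_mul, mul_comm]
    congr 1
    rw [← (hmp i).map_eq, variance_map hf.aemeasurable (hmp i).measurable.aemeasurable]
    rfl
  rw [← hvar, ← hmean, ← evariance_eq_lintegral_ofReal, ← ofReal_variance]
  simpa using memLp_finsetSum Finset.univ fun i _ => hL' i

lemma Matrix.IsSymm.exists_diagonalization {n : ℕ} {M : Matrix (Fin n) (Fin n) ℝ} (hM : M.IsSymm) :
    ∃ (Q : Matrix (Fin n) (Fin n) ℝ) (a : Fin n → ℝ), Qᵀ * Q = 1 ∧ Q * Qᵀ = 1 ∧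
      M = Q * diagonal a * Qᵀ := by
  have hH : M.IsHermitian := by
    rw [Matrix.IsHermitian, Matrix.conjTranspose_eq_transpose_of_trivial]; exact hM
  have h := hH.spectral_theorem
  refine ⟨hH.eigenvectorUnitary, hH.eigenvalues, ?_, ?_, ?_⟩
  · have := Unitary.coe_star_mul_self hH.eigenvectorUnitary
    rwa [Matrix.star_eq_conjTranspose, Matrix.conjTranspose_eq_transpose_of_trivial] at this
  · have := Unitary.coe_mul_star_self hH.eigenvectorUnitary
    rwa [Unitary.coe_star, Matrix.star_eq_conjTranspose, Matrix.conjTranspose_eq_transpose_of_trivial] at this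
  · rw [Unitary.conjStarAlgAut_apply, Matrix.star_eq_conjTranspose,
      Matrix.conjTranspose_eq_transpose_of_trivial] at h
    exact h

/-- The variance of a Gaussian quadratic form. -/
lemma lintegral_quadForm_sub_sq {n : ℕ} (v : NNReal) {M : Matrix (Fin n) (Fin n) ℝ}
    (hM : M.IsSymm) :
    ∫⁻ g, ENNReal.ofReal ((g ⬝ᵥ M *ᵥ g - v * M.trace) ^ 2) ∂(gaussVec n v)
      = ENNReal.ofReal (gaussSqVar * v ^ 2 * (M * M).trace) := by
  obtain ⟨Q, a, hQ1, hQ2, rfl⟩ := hM.exists_diagonalization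
  have htr : (Q * diagonal a * Qᵀ).trace = ∑ i, a i := by
    rw [Matrix.trace_mul_cycle, hQ1, one_mul, Matrix.trace_diagonal]
  have htr2 : ((Q * diagonal a * Qᵀ) * (Q * diagonal a * Qᵀ)).trace = ∑ i, a i ^ 2 := by
    have : (Q * diagonal a * Qᵀ) * (Q * diagonal a * Qᵀ)
        = Q * diagonal (fun i => a i * a i) * Qᵀ := by
      calc _ = Q * diagonal a * (Qᵀ * Q) * diagonal a * Qᵀ := by simp only [Matrix.mul_assoc]
        _ = _ := by rw [hQ1, mul_one, Matrix.mul_assoc Q, Matrix.diagonal_mul_diagonal]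
    rw [this, Matrix.trace_mul_cycle, hQ1, one_mul, Matrix.trace_diagonal]
    simp [pow_two]
  have hq : ∀ g : Fin n → ℝ, g ⬝ᵥ (Q * diagonal a * Qᵀ) *ᵥ g = ∑ i, a i * (Qᵀ *ᵥ g) i ^ 2 := by
    intro g
    rw [← Matrix.mulVec_mulVec, ← Matrix.mulVec_mulVec, Matrix.dotProduct_mulVec,
      ← Matrix.mulVec_transpose, dotProduct]
    refine Finset.sum_congr rfl fun i _ => ?_
    rw [Matrix.mulVec_diagonal]; ring
  simp_rw [hq, htr, htr2]
  have h := lintegral_sum_sub_sq v (fun x => x ^ 2) (by fun_prop) (memLp_sq_gaussianReal v) a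
  rw [integral_sq_gaussianReal, variance_sq_gaussianReal] at h
  rw [← h, ← (gaussVec_map_orthogonal v Qᵀ (by simpa using hQ2)).lintegral_comp
    (f := fun g => ENNReal.ofReal ((∑ i, a i * g i ^ 2 - v * ∑ i, a i) ^ 2)) (by fun_prop)]

lemma lintegral_linearForm_sq {n : ℕ} (v : NNReal) (w : Fin n → ℝ) :
    ∫⁻ g, ENNReal.ofReal ((w ⬝ᵥ g) ^ 2) ∂(gaussVec n v) = ENNReal.ofReal (v * (w ⬝ᵥ w)) := by
  have h := lintegral_sum_sub_sq v (fun x => x) (by fun_prop)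
    (memLp_id_gaussianReal' 2 (by simp)) w
  rw [integral_id_gaussianReal, variance_fun_id_gaussianReal] at h
  simpa [dotProduct, pow_two] using h

lemma gaussVec_linearForm_eq_zero {n : ℕ} {v : NNReal} (hv : v ≠ 0) {w : Fin n → ℝ} (hw : w ≠ 0) :
    gaussVec n v {g | w ⬝ᵥ g = 0} = 0 := by
  obtain ⟨i, -⟩ := Function.ne_iff.mp hw
  have hww : 0 < w ⬝ᵥ w := by
    simpa using (dotProduct_star_self_pos_iff (v := w)).mpr hw
  obtain ⟨Q, hQ1, hQ2, hQ⟩ := exists_orthogonal_mulVec (Pi.single i √(w ⬝ᵥ w)) w (by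
    simp [Real.mul_self_sqrt hww.le])
  have hset : {g | w ⬝ᵥ g = 0} = (fun x => Qᵀ *ᵥ x) ⁻¹' (Function.eval i ⁻¹' {0}) := by
    ext g
    have : w ⬝ᵥ g = √(w ⬝ᵥ w) * (Qᵀ *ᵥ g) i := by
      conv_lhs => rw [← hQ]
      rw [dotProduct_comm, Matrix.dotProduct_mulVec, ← Matrix.mulVec_transpose]
      simp [mul_comm]
    simp [this, (Real.sqrt_pos.mpr hww).ne']
  have := nullSingletonClass_gaussianReal (μ := 0) hv
  have hev : MeasurePreserving (Function.eval i) (gaussVec n v) (gaussianReal 0 v) :=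
    measurePreserving_eval (fun _ : Fin n => gaussianReal 0 v) i
  have h0 := ((hev.comp (gaussVec_map_orthogonal v Qᵀ (by simpa using hQ2))).measure_preimage
    (MeasurableSet.singleton 0).nullMeasurableSet)
  rw [hset, ← Set.preimage_comp, h0, measure_singleton]

instance {m n : ℕ} : BorelSpace (Matrix (Fin m) (Fin n) ℝ) :=
  inferInstanceAs (BorelSpace (Fin m → Fin n → ℝ))

instance {m n : ℕ} : SecondCountableTopology (Matrix (Fin m) (Fin n) ℝ) :=
  inferInstanceAs (SecondCountableTopology (Fin m → Fin n → ℝ))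

section Measurability

variable {Ω : Type*} [MeasurableSpace Ω] {m n p : ℕ}

lemma measurable_matrix_inv :
    Measurable (fun M : Matrix (Fin n) (Fin n) ℝ => M⁻¹) := by
  have h : (fun M : Matrix (Fin n) (Fin n) ℝ => M⁻¹) = fun M => (M.det)⁻¹ • M.adjugate := by
    ext M : 1
    rw [Matrix.inv_def, Ring.inverse_eq_inv']
  rw [h]
  refine measurable_pi_iff.mpr fun i => measurable_pi_iff.mpr fun j => ?_
  have h1 : Measurable fun M : Matrix (Fin n) (Fin n) ℝ => M.det :=
    (Continuous.matrix_det continuous_id).measurable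
  have h2 : Measurable fun M : Matrix (Fin n) (Fin n) ℝ => M.adjugate i j :=
    ((Continuous.matrix_adjugate continuous_id).matrix_elem i j).measurable
  exact h1.inv.mul h2

lemma Measurable.matrix_mul {A : Ω → Matrix (Fin m) (Fin n) ℝ} {B : Ω → Matrix (Fin n) (Fin p) ℝ}
    (hA : Measurable A) (hB : Measurable B) : Measurable fun ω => A ω * B ω := by
  have : Continuous fun P : Matrix (Fin m) (Fin n) ℝ × Matrix (Fin n) (Fin p) ℝ => P.1 * P.2 :=
    continuous_fst.matrix_mul continuous_snd
  exact this.measurable.comp (hA.prodMk hB)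

lemma Measurable.matrix_transpose {A : Ω → Matrix (Fin m) (Fin n) ℝ} (hA : Measurable A) :
    Measurable fun ω => (A ω)ᵀ :=
  (continuous_id.matrix_transpose).measurable.comp hA

lemma Measurable.matrix_inv {A : Ω → Matrix (Fin n) (Fin n) ℝ} (hA : Measurable A) :
    Measurable fun ω => (A ω)⁻¹ :=
  measurable_matrix_inv.comp hA

lemma Measurable.matrix_mulVec {A : Ω → Matrix (Fin m) (Fin n) ℝ} {x : Ω → Fin n → ℝ}
    (hA : Measurable A) (hx : Measurable x) : Measurable fun ω => A ω *ᵥ x ω := by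
  have : Continuous fun P : Matrix (Fin m) (Fin n) ℝ × (Fin n → ℝ) => P.1 *ᵥ P.2 :=
    continuous_fst.matrix_mulVec continuous_snd
  exact this.measurable.comp (hA.prodMk hx)

lemma Measurable.matrix_dotProduct {x y : Ω → Fin n → ℝ}
    (hx : Measurable x) (hy : Measurable y) : Measurable fun ω => x ω ⬝ᵥ y ω := by
  have : Continuous fun P : (Fin n → ℝ) × (Fin n → ℝ) => P.1 ⬝ᵥ P.2 :=
    continuous_fst.dotProduct continuous_snd
  exact this.measurable.comp (hx.prodMk hy)

lemma Measurable.matrix_pinv {A : Ω → Matrix (Fin m) (Fin n) ℝ} (hA : Measurable A) :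
    Measurable fun ω => pinv (A ω) :=
  ((hA.matrix_transpose.matrix_mul hA).matrix_inv).matrix_mul hA.matrix_transpose

end Measurability

section Algebra

variable {d N : ℕ}

lemma mulVec_dotProduct (A : Matrix (Fin d) (Fin N) ℝ) (x : Fin N → ℝ) (z : Fin d → ℝ) :
    (A *ᵥ x) ⬝ᵥ z = x ⬝ᵥ Aᵀ *ᵥ z := by
  rw [Matrix.dotProduct_mulVec, Matrix.vecMul_transpose]

lemma mulVec_dotProduct_mulVec (A : Matrix (Fin d) (Fin N) ℝ) (x y : Fin N → ℝ) :
    (A *ᵥ x) ⬝ᵥ (A *ᵥ y) = x ⬝ᵥ (Aᵀ * A) *ᵥ y := by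
  rw [mulVec_dotProduct, Matrix.mulVec_mulVec]

lemma transpose_gram_inv (A : Matrix (Fin d) (Fin N) ℝ) : ((Aᵀ * A)⁻¹)ᵀ = (Aᵀ * A)⁻¹ := by
  rw [Matrix.transpose_nonsing_inv, Matrix.transpose_mul, Matrix.transpose_transpose]

lemma gram_inv_mul_gram_mul_gram_inv (A : Matrix (Fin d) (Fin N) ℝ) :
    (Aᵀ * A)⁻¹ * (Aᵀ * A) * (Aᵀ * A)⁻¹ = (Aᵀ * A)⁻¹ := by
  by_cases h : IsUnit (Aᵀ * A).det
  · rw [Matrix.nonsing_inv_mul _ h, one_mul]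
  · rw [Matrix.nonsing_inv_apply_not_isUnit _ h]; simp

lemma pinv_mul_transpose_pinv (A : Matrix (Fin d) (Fin N) ℝ) :
    pinv A * (pinv A)ᵀ = (Aᵀ * A)⁻¹ := by
  rw [pinv, Matrix.transpose_mul, transpose_gram_inv, Matrix.transpose_transpose,
    Matrix.mul_assoc, ← Matrix.mul_assoc Aᵀ, ← Matrix.mul_assoc, gram_inv_mul_gram_mul_gram_inv]

lemma transpose_mul_pinv (A : Matrix (Fin d) (Fin N) ℝ) : (A * pinv A)ᵀ = A * pinv A := by
  rw [pinv, Matrix.transpose_mul, Matrix.transpose_mul, transpose_gram_inv,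
    Matrix.transpose_transpose, Matrix.mul_assoc]

lemma mul_pinv_idem (A : Matrix (Fin d) (Fin N) ℝ) :
    (A * pinv A) * (A * pinv A) = A * pinv A := by
  calc (A * pinv A) * (A * pinv A)
      = A * ((Aᵀ * A)⁻¹ * (Aᵀ * A) * (Aᵀ * A)⁻¹) * Aᵀ := by simp only [pinv, Matrix.mul_assoc]
    _ = A * pinv A := by rw [gram_inv_mul_gram_mul_gram_inv, pinv, Matrix.mul_assoc]

lemma pinv_mul_self {A : Matrix (Fin d) (Fin N) ℝ} (h : IsUnit (Aᵀ * A).det) :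
    pinv A * A = 1 := by
  rw [pinv, Matrix.mul_assoc, Matrix.nonsing_inv_mul _ h]

lemma trace_mul_pinv {A : Matrix (Fin d) (Fin N) ℝ} (h : IsUnit (Aᵀ * A).det) :
    (A * pinv A).trace = N := by
  rw [Matrix.trace_mul_comm, pinv_mul_self h, Matrix.trace_one, Fintype.card_fin]

lemma pinv_orthogonal_mul {Q : Matrix (Fin d) (Fin d) ℝ} (hQ : Qᵀ * Q = 1)
    (A : Matrix (Fin d) (Fin N) ℝ) : pinv (Q * A) = pinv A * Qᵀ := by
  have : (Q * A)ᵀ * (Q * A) = Aᵀ * A := by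
    rw [Matrix.transpose_mul, Matrix.mul_assoc, ← Matrix.mul_assoc Qᵀ, hQ, Matrix.one_mul]
  rw [pinv, this, pinv, Matrix.transpose_mul, Matrix.mul_assoc]

lemma gram_inv_mul_orthogonal {Q : Matrix (Fin N) (Fin N) ℝ} (hQ : Qᵀ * Q = 1) (hQ' : Q * Qᵀ = 1)
    (A : Matrix (Fin d) (Fin N) ℝ) :
    ((A * Q)ᵀ * (A * Q))⁻¹ = Qᵀ * (Aᵀ * A)⁻¹ * Q := by
  have hinv : Q⁻¹ = Qᵀ := Matrix.inv_eq_left_inv hQ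
  have hinv' : Qᵀ⁻¹ = Q := Matrix.inv_eq_left_inv hQ'
  rw [Matrix.transpose_mul, Matrix.mul_assoc, ← Matrix.mul_assoc Aᵀ, Matrix.mul_inv_rev,
    Matrix.mul_inv_rev, hinv, hinv']

/-- The projection onto the orthogonal complement of the column space. -/
noncomputable def coproj (A : Matrix (Fin d) (Fin N) ℝ) : Matrix (Fin d) (Fin d) ℝ :=
  1 - A * pinv A

lemma coproj_isSymm (A : Matrix (Fin d) (Fin N) ℝ) : (coproj A).IsSymm := by
  rw [Matrix.IsSymm, coproj, Matrix.transpose_sub, transpose_mul_pinv, Matrix.transpose_one]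

lemma coproj_idem (A : Matrix (Fin d) (Fin N) ℝ) : coproj A * coproj A = coproj A := by
  rw [coproj, sub_mul, one_mul, mul_sub, mul_one, mul_pinv_idem]; abel

lemma coproj_mul_self {A : Matrix (Fin d) (Fin N) ℝ} (h : IsUnit (Aᵀ * A).det) :
    coproj A * A = 0 := by
  rw [coproj, Matrix.sub_mul, Matrix.one_mul, Matrix.mul_assoc, pinv_mul_self h, Matrix.mul_one, sub_self]

lemma trace_coproj {A : Matrix (Fin d) (Fin N) ℝ} (h : IsUnit (Aᵀ * A).det) :
    (coproj A).trace = d - N := by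
  rw [coproj, Matrix.trace_sub, trace_mul_pinv h, Matrix.trace_one, Fintype.card_fin]

lemma dotProduct_coproj_mulVec (A : Matrix (Fin d) (Fin N) ℝ) (a : Fin d → ℝ) :
    a ⬝ᵥ coproj A *ᵥ a = (coproj A *ᵥ a) ⬝ᵥ (coproj A *ᵥ a) := by
  rw [mulVec_dotProduct_mulVec, (coproj_isSymm A).eq, coproj_idem]

lemma mulVec_eq_head_add_tail {n : ℕ} (A : Matrix (Fin d) (Fin (n + 1)) ℝ) (y : Fin (n + 1) → ℝ) :
    A *ᵥ y = y 0 • (fun i => A i 0) + A.submatrix id Fin.succ *ᵥ (fun j => y j.succ) := by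
  ext i
  simp [Matrix.mulVec, dotProduct, Fin.sum_univ_succ, mul_comm]

lemma isUnit_gram_of_head_tail {n : ℕ} {A : Matrix (Fin d) (Fin (n + 1)) ℝ}
    (hB : IsUnit ((A.submatrix id Fin.succ)ᵀ * A.submatrix id Fin.succ).det)
    (hq : (fun i => A i 0) ⬝ᵥ coproj (A.submatrix id Fin.succ) *ᵥ (fun i => A i 0) ≠ 0) :
    IsUnit (Aᵀ * A).det := by
  set B := A.submatrix id Fin.succ with hBdef
  set a : Fin d → ℝ := fun i => A i 0 with ha
  rw [isUnit_iff_ne_zero]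
  intro h0
  obtain ⟨y, hy, hy0⟩ := Matrix.exists_mulVec_eq_zero_iff.mpr h0
  have hAy : A *ᵥ y = 0 := by
    rw [← dotProduct_self_eq_zero, mulVec_dotProduct_mulVec, hy0, dotProduct_zero]
  have hdec := mulVec_eq_head_add_tail A y
  rw [hAy] at hdec
  have h1 : y 0 = 0 := by
    have := congrArg (fun z => a ⬝ᵥ coproj B *ᵥ z) hdec
    simp only [Matrix.mulVec_add, Matrix.mulVec_smul, Matrix.mulVec_mulVec,
      ← hBdef, coproj_mul_self hB, Matrix.mulVec_zero, Matrix.zero_mulVec, add_zero,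
      dotProduct_zero, dotProduct_smul, smul_eq_mul] at this
    exact (mul_eq_zero.mp this.symm).resolve_right hq
  rw [h1, zero_smul, zero_add] at hdec
  have h2 : (fun j : Fin n => y j.succ) = 0 := by
    have := congrArg (fun z => pinv B *ᵥ z) hdec
    simpa [Matrix.mulVec_mulVec, ← hBdef, pinv_mul_self hB] using this.symm
  refine hy (funext fun j => ?_)
  refine Fin.cases h1 (fun k => congrFun h2 k) j

lemma gram_inv_zero_zero {n : ℕ} {A : Matrix (Fin d) (Fin (n + 1)) ℝ}
    (hB : IsUnit ((A.submatrix id Fin.succ)ᵀ * A.submatrix id Fin.succ).det)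
    (hA : IsUnit (Aᵀ * A).det) :
    ((Aᵀ * A)⁻¹ 0 0)⁻¹
      = (fun i => A i 0) ⬝ᵥ coproj (A.submatrix id Fin.succ) *ᵥ (fun i => A i 0) := by
  set B := A.submatrix id Fin.succ with hBdef
  set a : Fin d → ℝ := fun i => A i 0 with ha
  set q := a ⬝ᵥ coproj B *ᵥ a with hq
  let x : Fin (n + 1) → ℝ := Fin.cons 1 (-(pinv B *ᵥ a))
  have hAx : A *ᵥ x = coproj B *ᵥ a := by
    rw [mulVec_eq_head_add_tail]
    simp only [x, Fin.cons_zero, Fin.cons_succ, one_smul, ← hBdef, ← ha]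
    change a + B *ᵥ (-(pinv B *ᵥ a)) = _
    rw [Matrix.mulVec_neg, Matrix.mulVec_mulVec, coproj, Matrix.sub_mulVec, Matrix.one_mulVec]
    abel
  have hBM : Bᵀ * coproj B = 0 := by
    rw [← (coproj_isSymm B).eq, ← Matrix.transpose_mul, coproj_mul_self hB, Matrix.transpose_zero]
  have hGx : (Aᵀ * A) *ᵥ x = q • Pi.single 0 1 := by
    rw [← Matrix.mulVec_mulVec, hAx]
    ext j
    refine Fin.cases ?_ (fun k => ?_) j
    · simp [hq, Matrix.mulVec, dotProduct, ha]
    · have := congrFun (congrArg (fun M => M *ᵥ a) hBM) k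
      simp only [← Matrix.mulVec_mulVec, Matrix.zero_mulVec] at this
      simpa [Matrix.mulVec, dotProduct, hBdef] using this
  have hx : x = q • (Aᵀ * A)⁻¹ *ᵥ Pi.single 0 1 := by
    rw [← Matrix.mulVec_smul, ← hGx, Matrix.mulVec_mulVec, Matrix.nonsing_inv_mul _ hA,
      Matrix.one_mulVec]
  have h0 : 1 = q * (Aᵀ * A)⁻¹ 0 0 := by
    have := congrFun hx 0
    simpa [x] using this
  exact inv_eq_of_mul_eq_one_left h0.symm

end Algebra

/-- The tail columns and the first column of a Gaussian matrix are independent. -/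
lemma gaussMatrix_tail_head (d n : ℕ) (v : NNReal) :
    MeasurePreserving
      (fun A : Matrix (Fin d) (Fin (n + 1)) ℝ => (A.submatrix id Fin.succ, fun i => A i 0))
      (gaussMatrix d (n + 1) v) ((gaussMatrix d n v).prod (gaussVec d v)) := by
  have h1 := gaussMatrix_transpose d (n + 1) v
  have h2 := measurePreserving_piFinSuccAbove (fun _ : Fin (n + 1) => gaussVec d v) 0
  have h3 := (MeasurePreserving.id (gaussVec d v)).prod (gaussMatrix_transpose n d v)
  have h4 := (Measure.measurePreserving_swap (μ := gaussVec d v) (ν := gaussMatrix d n v)).comp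
    (h3.comp (h2.comp h1))
  convert! h4 using 1

lemma measurable_entry {d N : ℕ} (i : Fin d) (j : Fin N) :
    Measurable fun A : Matrix (Fin d) (Fin N) ℝ => A i j :=
  (measurable_pi_apply j).comp (measurable_pi_apply i)

lemma measurable_coproj {d N : ℕ} : Measurable (coproj (d := d) (N := N)) := by
  have h : Measurable fun A : Matrix (Fin d) (Fin N) ℝ => A * pinv A :=
    measurable_id.matrix_mul measurable_id.matrix_pinv
  refine measurable_pi_iff.mpr fun i => measurable_pi_iff.mpr fun j => ?_
  exact ((measurable_entry i j).comp h).const_sub _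

lemma measurableSet_isUnit_gram {d N : ℕ} :
    MeasurableSet {A : Matrix (Fin d) (Fin N) ℝ | IsUnit (Aᵀ * A).det} := by
  have h : Measurable fun A : Matrix (Fin d) (Fin N) ℝ => (Aᵀ * A).det :=
    Continuous.measurable (by fun_prop)
  simp_rw [isUnit_iff_ne_zero]
  exact h (MeasurableSet.singleton 0).compl

lemma measurable_coproj_form {d n : ℕ} : Measurable
    (fun P : Matrix (Fin d) (Fin n) ℝ × (Fin d → ℝ) => P.2 ⬝ᵥ coproj P.1 *ᵥ P.2) :=
  measurable_snd.matrix_dotProduct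
    ((measurable_coproj.comp measurable_fst).matrix_mulVec measurable_snd)

/-- A tall Gaussian matrix almost surely has full column rank. -/
lemma ae_isUnit_gram {d N : ℕ} {v : NNReal} (hv : v ≠ 0) (hN : N ≤ d) :
    ∀ᵐ A ∂(gaussMatrix d N v), IsUnit (Aᵀ * A).det := by
  induction N with
  | zero => exact Eventually.of_forall fun A => by simp
  | succ n ih =>
    have ih := ih (by omega)
    have hae : ∀ᵐ P ∂((gaussMatrix d n v).prod (gaussVec d v)),
        IsUnit (P.1ᵀ * P.1).det ∧ P.2 ⬝ᵥ coproj P.1 *ᵥ P.2 ≠ 0 := by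
      have hms : MeasurableSet {P : Matrix (Fin d) (Fin n) ℝ × (Fin d → ℝ) |
          IsUnit (P.1ᵀ * P.1).det ∧ P.2 ⬝ᵥ coproj P.1 *ᵥ P.2 ≠ 0} :=
        (measurable_fst measurableSet_isUnit_gram).inter
          (measurable_coproj_form (MeasurableSet.singleton 0).compl)
      rw [ae_iff]
      refine (Measure.measure_prod_null hms.compl).mpr ?_
      filter_upwards [ih] with B hB
      have hne : coproj B ≠ 0 := by
        intro h
        have := trace_coproj hB
        rw [h, Matrix.trace_zero] at this
        have : (n : ℝ) = d := by linarith
        have : n = d := by exact_mod_cast this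
        omega
      obtain ⟨i, hi⟩ : ∃ i, coproj B i ≠ 0 := by
        by_contra! hcon
        exact hne (funext hcon)
      refine measure_mono_null (fun a ha => ?_) (gaussVec_linearForm_eq_zero hv hi)
      have h0 : a ⬝ᵥ coproj B *ᵥ a = 0 := by
        by_contra hcon
        exact ha ⟨hB, hcon⟩
      rw [dotProduct_coproj_mulVec, dotProduct_self_eq_zero] at h0
      exact congrFun h0 i
    filter_upwards [(gaussMatrix_tail_head d n v).quasiMeasurePreserving.ae hae] with A hA
    exact isUnit_gram_of_head_tail hA.1 hA.2

lemma trace_coproj_sq {d N : ℕ} {A : Matrix (Fin d) (Fin N) ℝ} (h : IsUnit (Aᵀ * A).det) :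
    (coproj A * coproj A).trace = d - N := by
  rw [coproj_idem, trace_coproj h]

lemma measurable_gram_inv {d N : ℕ} :
    Measurable fun A : Matrix (Fin d) (Fin N) ℝ => (Aᵀ * A)⁻¹ :=
  (measurable_id.matrix_transpose.matrix_mul measurable_id).matrix_inv

lemma measurable_gram_inv_form {d N : ℕ} (y : Fin N → ℝ) :
    Measurable fun A : Matrix (Fin d) (Fin N) ℝ => y ⬝ᵥ (Aᵀ * A)⁻¹ *ᵥ y :=
  measurable_const.matrix_dotProduct (measurable_gram_inv.matrix_mulVec measurable_const)

lemma lintegral_gram_inv_zero_zero {d n : ℕ} {v : NNReal} (hv : v ≠ 0) (hn : n + 1 ≤ d) :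
    ∫⁻ A, ENNReal.ofReal ((((Aᵀ * A)⁻¹ 0 0)⁻¹ - v * (d - n)) ^ 2) ∂(gaussMatrix d (n + 1) v)
      = ENNReal.ofReal (gaussSqVar * v ^ 2 * (d - n)) := by
  have hA := ae_isUnit_gram hv hn
  have hB := ae_isUnit_gram (N := n) hv (by omega : n ≤ d)
  have hB' : ∀ᵐ P ∂((gaussMatrix d n v).prod (gaussVec d v)), IsUnit (P.1ᵀ * P.1).det :=
    Measure.quasiMeasurePreserving_fst.ae hB
  have hB'' := (gaussMatrix_tail_head d n v).quasiMeasurePreserving.ae hB'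
  have hmeas : Measurable (fun P : Matrix (Fin d) (Fin n) ℝ × (Fin d → ℝ) =>
      ENNReal.ofReal ((P.2 ⬝ᵥ coproj P.1 *ᵥ P.2 - v * (d - n)) ^ 2)) :=
    ((measurable_coproj_form.sub_const _).pow_const 2).ennreal_ofReal
  calc _ = ∫⁻ A, (fun P : Matrix (Fin d) (Fin n) ℝ × (Fin d → ℝ) =>
      ENNReal.ofReal ((P.2 ⬝ᵥ coproj P.1 *ᵥ P.2 - v * (d - n)) ^ 2))
        ((A.submatrix id Fin.succ, fun i => A i 0)) ∂(gaussMatrix d (n + 1) v) := by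
        refine lintegral_congr_ae ?_
        filter_upwards [hA, hB''] with A h1 h2
        rw [gram_inv_zero_zero h2 h1]
    _ = ∫⁻ B, ∫⁻ a, ENNReal.ofReal ((a ⬝ᵥ coproj B *ᵥ a - v * (d - n)) ^ 2)
          ∂(gaussVec d v) ∂(gaussMatrix d n v) := by
        rw [(gaussMatrix_tail_head d n v).lintegral_comp hmeas,
          lintegral_prod _ hmeas.aemeasurable]
    _ = ∫⁻ B, ENNReal.ofReal (gaussSqVar * v ^ 2 * (d - n)) ∂(gaussMatrix d n v) := by
        refine lintegral_congr_ae ?_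
        filter_upwards [hB] with B h
        have := lintegral_quadForm_sub_sq v (coproj_isSymm B)
        rwa [trace_coproj_sq h, trace_coproj h] at this
    _ = _ := by simp

/-- Concentration of the Schur complement `1 / (yᵀ (AᵀA)⁻¹ y)` for a unit vector `y`. -/
lemma lintegral_inv_gram_inv_form {d N : ℕ} {v : NNReal} (hv : v ≠ 0) (hN : N ≤ d)
    {y : Fin N → ℝ} (hy : y ⬝ᵥ y = 1) :
    ∫⁻ A, ENNReal.ofReal (((y ⬝ᵥ (Aᵀ * A)⁻¹ *ᵥ y)⁻¹ - v * (d - N + 1)) ^ 2) ∂(gaussMatrix d N v)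
      = ENNReal.ofReal (gaussSqVar * v ^ 2 * (d - N + 1)) := by
  obtain _ | n := N
  · simp at hy
  obtain ⟨Q, hQ1, hQ2, hQ⟩ := exists_orthogonal_mulVec (Pi.single 0 1) y (by simp [hy])
  have h := lintegral_gram_inv_zero_zero hv hN
  have hcast : (d : ℝ) - (n + 1 : ℕ) + 1 = d - n := by push_cast; ring
  have hm : Measurable fun A : Matrix (Fin d) (Fin (n + 1)) ℝ =>
      ENNReal.ofReal ((((Aᵀ * A)⁻¹ 0 0)⁻¹ - v * (d - n)) ^ 2) :=
    ((((measurable_entry 0 0).comp measurable_gram_inv).inv.sub_const _).pow_const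
      2).ennreal_ofReal
  rw [hcast, ← h, ← (gaussMatrix_mul_orthogonal v Q hQ2).lintegral_comp hm]
  refine lintegral_congr fun A => ?_
  have : y ⬝ᵥ (Aᵀ * A)⁻¹ *ᵥ y = ((A * Q)ᵀ * (A * Q))⁻¹ 0 0 := by
    rw [gram_inv_mul_orthogonal hQ1 hQ2, ← hQ, mulVec_dotProduct,
      Matrix.mulVec_mulVec, Matrix.mulVec_mulVec, Matrix.mul_assoc]
    simp
  rw [this]

lemma lintegral_mulVec_sq {d N : ℕ} (v : NNReal) {y : Fin N → ℝ} (hy : y ⬝ᵥ y = 1) :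
    ∫⁻ A, ENNReal.ofReal (((A *ᵥ y) ⬝ᵥ (A *ᵥ y) - v * d) ^ 2) ∂(gaussMatrix d N v)
      = ENNReal.ofReal (gaussSqVar * v ^ 2 * d) := by
  obtain _ | n := N
  · simp at hy
  obtain ⟨Q, hQ1, hQ2, hQ⟩ := exists_orthogonal_mulVec (Pi.single 0 1) y (by simp [hy])
  have h := lintegral_quadForm_sub_sq (n := d) v (M := 1) (by simp)
  simp only [Matrix.one_mulVec, mul_one, Matrix.trace_one, Fintype.card_fin] at h
  have hcol : MeasurePreserving (fun A : Matrix (Fin d) (Fin (n + 1)) ℝ => fun i => A i 0)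
      (gaussMatrix d (n + 1) v) (gaussVec d v) :=
    measurePreserving_snd.comp (gaussMatrix_tail_head d n v)
  have hm : Measurable fun a : Fin d → ℝ => ENNReal.ofReal ((a ⬝ᵥ a - v * d) ^ 2) :=
    (Continuous.measurable (by fun_prop)).ennreal_ofReal
  rw [← h, ← (hcol.comp (gaussMatrix_mul_orthogonal v Q hQ2)).lintegral_comp hm]
  refine lintegral_congr fun A => ?_
  have : A *ᵥ y = fun i => (A * Q) i 0 := by
    rw [← hQ, Matrix.mulVec_mulVec]; ext i; simp
  rw [this]
  rfl

lemma lintegral_dotProduct_self (d : ℕ) :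
    ∫⁻ g, ENNReal.ofReal (g ⬝ᵥ g) ∂(gaussVec d 1) = d := by
  have h1 : ∀ g : Fin d → ℝ, ENNReal.ofReal (g ⬝ᵥ g)
      = ∑ i, ENNReal.ofReal ((Pi.single i 1 ⬝ᵥ g) ^ 2) := fun g => by
    rw [← ENNReal.ofReal_sum_of_nonneg fun i _ => sq_nonneg _]
    simp only [single_one_dotProduct, pow_two]
    rfl
  simp_rw [h1]
  rw [lintegral_finsetSum _ fun i _ =>
    (Continuous.measurable (by fun_prop)).ennreal_ofReal]
  simp_rw [lintegral_linearForm_sq]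
  simp

lemma sq_le_lintegral_dotProduct_self_sq (d : ℕ) :
    (d : ENNReal) ^ 2 ≤ ∫⁻ g, ENNReal.ofReal ((g ⬝ᵥ g) ^ 2) ∂(gaussVec d 1) := by
  have h : ∫⁻ g, ENNReal.ofReal (2 * d) * ENNReal.ofReal (g ⬝ᵥ g) ∂(gaussVec d 1)
      ≤ ∫⁻ g, (ENNReal.ofReal ((g ⬝ᵥ g) ^ 2) + (d : ENNReal) ^ 2) ∂(gaussVec d 1) := by
    refine lintegral_mono fun g => ?_
    have hd : (d : ENNReal) ^ 2 = ENNReal.ofReal ((d : ℝ) ^ 2) := by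
      rw [ENNReal.ofReal_pow (by positivity), ENNReal.ofReal_natCast]
    rw [hd, ← ENNReal.ofReal_mul (by positivity), ← ENNReal.ofReal_add (by positivity)
      (by positivity)]
    refine ENNReal.ofReal_le_ofReal ?_
    nlinarith [sq_nonneg (g ⬝ᵥ g - d)]
  have hc : Measurable fun g : Fin d → ℝ => ENNReal.ofReal (g ⬝ᵥ g) :=
    (Continuous.measurable (by fun_prop)).ennreal_ofReal
  rw [lintegral_const_mul _ hc, lintegral_dotProduct_self, lintegral_add_right _ measurable_const,
    lintegral_const, measure_univ, mul_one] at h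
  have h2 : ENNReal.ofReal (2 * d) * (d : ENNReal) = (d : ENNReal) ^ 2 + (d : ENNReal) ^ 2 := by
    rw [ENNReal.ofReal_mul (by norm_num), ENNReal.ofReal_natCast]
    simp; ring
  rw [h2] at h
  exact (ENNReal.add_le_add_iff_right (by simp)).mp h

/-- Replacing a unit vector by an independent Gaussian vector, by rotational invariance. -/
lemma lintegral_mul_lintegral_gaussVec {d N : ℕ} (v : NNReal) (m : ℕ)
    (φ : Matrix (Fin d) (Fin N) ℝ → (Fin d → ℝ) → ENNReal)
    (hφ : Measurable (Function.uncurry φ))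
    (hinv : ∀ Q : Matrix (Fin d) (Fin d) ℝ, Qᵀ * Q = 1 → ∀ A x, φ (Q * A) (Q *ᵥ x) = φ A x)
    (hhom : ∀ A x (t : ℝ), φ A (t • x) = ENNReal.ofReal ((t ^ 2) ^ m) * φ A x)
    {u : Fin d → ℝ} (hu : u ⬝ᵥ u = 1) :
    (∫⁻ g, ENNReal.ofReal ((g ⬝ᵥ g) ^ m) ∂(gaussVec d 1)) * ∫⁻ A, φ A u ∂(gaussMatrix d N v)
      = ∫⁻ A, ∫⁻ g, φ A g ∂(gaussVec d 1) ∂(gaussMatrix d N v) := by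
  rw [lintegral_lintegral_swap hφ.aemeasurable,
    ← lintegral_mul_const _ (Continuous.measurable (by fun_prop)).ennreal_ofReal]
  refine lintegral_congr fun g => ?_
  have hg0 : 0 ≤ g ⬝ᵥ g := by simpa using dotProduct_star_self_nonneg g
  obtain ⟨Q, hQ1, -, hQ⟩ := exists_orthogonal_mulVec (√(g ⬝ᵥ g) • u) g (by
    simp only [smul_dotProduct, dotProduct_smul, hu, smul_eq_mul, mul_one]
    exact Real.mul_self_sqrt hg0)
  have hφ' : ∀ x, Measurable fun A => φ A x := fun x => hφ.comp (measurable_id.prodMk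
    measurable_const)
  rw [← (gaussMatrix_orthogonal_mul v Q hQ1).lintegral_comp (hφ' g),
    ← lintegral_const_mul _ (hφ' u)]
  refine lintegral_congr fun A => ?_
  rw [← hQ, hinv Q hQ1, hhom, Real.sq_sqrt hg0, hQ]

lemma measurable_proj_form {d N : ℕ} : Measurable
    (fun P : Matrix (Fin d) (Fin N) ℝ × (Fin d → ℝ) => P.2 ⬝ᵥ (P.1 * pinv P.1) *ᵥ P.2) :=
  measurable_snd.matrix_dotProduct
    ((measurable_fst.matrix_mul measurable_fst.matrix_pinv).matrix_mulVec measurable_snd)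

/-- Concentration of the projection `A A†` on a unit vector. -/
lemma lintegral_proj_form_le {d N : ℕ} {v : NNReal} (hv : v ≠ 0) (hN : N ≤ d)
    {u : Fin d → ℝ} (hu : u ⬝ᵥ u = 1) :
    ∫⁻ A : Matrix (Fin d) (Fin N) ℝ,
        ENNReal.ofReal ((u ⬝ᵥ (A * pinv A) *ᵥ u - N / d) ^ 2) ∂(gaussMatrix d N v)
      ≤ ENNReal.ofReal (gaussSqVar / d) := by
  obtain _ | d := d
  · simp at hu
  set D : ℝ := ((d + 1 : ℕ) : ℝ) with hD
  have hD0 : 0 < D := by rw [hD]; positivity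
  have hND : (N : ℝ) ≤ D := by rw [hD]; exact_mod_cast hN
  let φ : Matrix (Fin (d + 1)) (Fin N) ℝ → (Fin (d + 1) → ℝ) → ENNReal := fun A x =>
    ENNReal.ofReal ((x ⬝ᵥ (A * pinv A) *ᵥ x - N / D * (x ⬝ᵥ x)) ^ 2)
  have hφ : Measurable (Function.uncurry φ) :=
    ((measurable_proj_form.sub
      ((measurable_snd.matrix_dotProduct measurable_snd).const_mul _)).pow_const 2).ennreal_ofReal
  have key := lintegral_mul_lintegral_gaussVec v 2 φ hφ (by
      intro Q hQ A x
      simp only [φ]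
      rw [pinv_orthogonal_mul hQ, mulVec_dotProduct_mulVec, hQ, Matrix.one_mulVec,
        mulVec_dotProduct, Matrix.mulVec_mulVec, Matrix.mulVec_mulVec]
      have : Qᵀ * (Q * A * (pinv A * Qᵀ)) * Q = A * pinv A := by
        calc Qᵀ * (Q * A * (pinv A * Qᵀ)) * Q = (Qᵀ * Q) * A * pinv A * (Qᵀ * Q) := by
              simp only [Matrix.mul_assoc]
          _ = _ := by rw [hQ, Matrix.one_mul, Matrix.mul_one]
      rw [this]) (by
      intro A x t
      simp only [φ]
      rw [← ENNReal.ofReal_mul (by positivity)]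
      congr 1
      simp only [Matrix.mulVec_smul, smul_dotProduct, dotProduct_smul, smul_eq_mul]
      ring) hu
  have hin : ∀ᵐ A ∂(gaussMatrix (d + 1) N v),
      ∫⁻ g, φ A g ∂(gaussVec (d + 1) 1) ≤ ENNReal.ofReal (gaussSqVar * D) := by
    filter_upwards [ae_isUnit_gram hv hN] with A hA
    have hM : (A * pinv A - (N / D) • (1 : Matrix (Fin (d + 1)) (Fin (d + 1)) ℝ)).IsSymm := by
      rw [Matrix.IsSymm, Matrix.transpose_sub, transpose_mul_pinv, Matrix.transpose_smul,
        Matrix.transpose_one]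
    have h := lintegral_quadForm_sub_sq 1 hM
    have htr : (A * pinv A - (N / D) • (1 : Matrix (Fin (d + 1)) (Fin (d + 1)) ℝ)).trace = 0 := by
      rw [Matrix.trace_sub, trace_mul_pinv hA, Matrix.trace_smul, Matrix.trace_one,
        Fintype.card_fin, ← hD, smul_eq_mul]
      field_simp; ring
    have htr2 : ((A * pinv A - (N / D) • (1 : Matrix (Fin (d + 1)) (Fin (d + 1)) ℝ)) *
        (A * pinv A - (N / D) • (1 : Matrix (Fin (d + 1)) (Fin (d + 1)) ℝ))).trace ≤ D := by
      rw [sub_mul, mul_sub, mul_sub, mul_pinv_idem]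
      simp only [Matrix.smul_mul, Matrix.mul_smul, mul_one, one_mul, Matrix.trace_sub,
        Matrix.trace_smul, trace_mul_pinv hA, Matrix.trace_one, Fintype.card_fin, ← hD, smul_eq_mul]
      have : (N : ℝ) / D * D = N := by field_simp
      rw [this]
      nlinarith [show 0 ≤ (N : ℝ) / D * N by positivity]
    rw [htr] at h
    have hform : ∀ g : Fin (d + 1) → ℝ,
        g ⬝ᵥ (A * pinv A - (N / D) • (1 : Matrix (Fin (d + 1)) (Fin (d + 1)) ℝ)) *ᵥ g
          = g ⬝ᵥ (A * pinv A) *ᵥ g - N / D * (g ⬝ᵥ g) := fun g => by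
      rw [Matrix.sub_mulVec, dotProduct_sub, Matrix.smul_mulVec, Matrix.one_mulVec,
        dotProduct_smul, smul_eq_mul]
    simp only [hform, mul_zero, sub_zero, NNReal.coe_one, one_pow, mul_one] at h
    refine h.le.trans (ENNReal.ofReal_le_ofReal ?_)
    exact mul_le_mul_of_nonneg_left htr2 gaussSqVar_nonneg
  have hout : ∫⁻ A, ∫⁻ g, φ A g ∂(gaussVec (d + 1) 1) ∂(gaussMatrix (d + 1) N v)
      ≤ ENNReal.ofReal (gaussSqVar * D) := by
    refine (lintegral_mono_ae hin).trans ?_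
    simp
  rw [← key] at hout
  have h2 := (mul_le_mul_left (sq_le_lintegral_dotProduct_self_sq (d + 1)) _).trans hout
  have hu' : ∀ A : Matrix (Fin (d + 1)) (Fin N) ℝ,
      φ A u = ENNReal.ofReal ((u ⬝ᵥ (A * pinv A) *ᵥ u - N / D) ^ 2) := fun A => by
    simp only [φ, hu, mul_one]
  simp only [hu'] at h2
  have hDE : ((d + 1 : ℕ) : ENNReal) = ENNReal.ofReal D := by rw [hD, ENNReal.ofReal_natCast]
  rw [hDE, ← ENNReal.ofReal_pow hD0.le, mul_comm, ← ENNReal.le_div_iff_mul_le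
    (Or.inl (by simp; positivity)) (Or.inl ENNReal.ofReal_ne_top),
    ← ENNReal.ofReal_div_of_pos (by positivity)] at h2
  refine h2.trans (ENNReal.ofReal_le_ofReal (le_of_eq ?_))
  field_simp

lemma dotProduct_pinv_mulVec_sq {d N : ℕ} (A : Matrix (Fin d) (Fin N) ℝ) (y : Fin N → ℝ) :
    ((pinv A)ᵀ *ᵥ y) ⬝ᵥ ((pinv A)ᵀ *ᵥ y) = y ⬝ᵥ (Aᵀ * A)⁻¹ *ᵥ y := by
  rw [mulVec_dotProduct_mulVec, Matrix.transpose_transpose, pinv_mul_transpose_pinv]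

/-- The bilinear form of the pseudoinverse is small where the inverse Gram form is bounded. -/
lemma lintegral_pinv_form_le {d N : ℕ} (v : NNReal) {u : Fin d → ℝ} (hu : u ⬝ᵥ u = 1)
    (y : Fin N → ℝ) (T : ℝ) :
    ∫⁻ A in {A : Matrix (Fin d) (Fin N) ℝ | y ⬝ᵥ (Aᵀ * A)⁻¹ *ᵥ y ≤ T},
        ENNReal.ofReal ((y ⬝ᵥ pinv A *ᵥ u) ^ 2) ∂(gaussMatrix d N v)
      ≤ ENNReal.ofReal (T / d) := by
  obtain _ | d := d
  · simp at hu
  set S : Set (Matrix (Fin (d + 1)) (Fin N) ℝ) := {A | y ⬝ᵥ (Aᵀ * A)⁻¹ *ᵥ y ≤ T} with hS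
  have hSm : MeasurableSet S := measurable_gram_inv_form y measurableSet_Iic
  let φ : Matrix (Fin (d + 1)) (Fin N) ℝ → (Fin (d + 1) → ℝ) → ENNReal := fun A x =>
    S.indicator (fun A => ENNReal.ofReal ((y ⬝ᵥ pinv A *ᵥ x) ^ 2)) A
  have hφ : Measurable (Function.uncurry φ) := by
    have : Function.uncurry φ = (Prod.fst ⁻¹' S).indicator
        (fun P => ENNReal.ofReal ((y ⬝ᵥ pinv P.1 *ᵥ P.2) ^ 2)) := by
      ext ⟨A, x⟩
      simp [φ, Function.uncurry, Set.indicator]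
    rw [this]
    exact (((measurable_const.matrix_dotProduct (measurable_fst.matrix_pinv.matrix_mulVec
      measurable_snd)).pow_const 2).ennreal_ofReal).indicator (measurable_fst hSm)
  have key := lintegral_mul_lintegral_gaussVec v 1 φ hφ (by
      intro Q hQ A x
      have hmem : Q * A ∈ S ↔ A ∈ S := by
        simp only [hS, Set.mem_ofPred_eq]
        rw [Matrix.transpose_mul, Matrix.mul_assoc, ← Matrix.mul_assoc Qᵀ, hQ, Matrix.one_mul]
      have hval : pinv (Q * A) *ᵥ (Q *ᵥ x) = pinv A *ᵥ x := by
        rw [pinv_orthogonal_mul hQ, Matrix.mulVec_mulVec, Matrix.mul_assoc, hQ, Matrix.mul_one]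
      simp only [φ, Set.indicator, hmem, hval]) (by
      intro A x t
      simp only [φ, Set.indicator]
      split_ifs
      · rw [← ENNReal.ofReal_mul (by positivity)]
        congr 1
        simp only [Matrix.mulVec_smul, dotProduct_smul, smul_eq_mul]
        ring
      · simp) hu
  have hin : ∀ A, ∫⁻ g, φ A g ∂(gaussVec (d + 1) 1) ≤ ENNReal.ofReal T := by
    intro A
    by_cases hA : A ∈ S
    · have h := lintegral_linearForm_sq 1 ((pinv A)ᵀ *ᵥ y)
      rw [dotProduct_pinv_mulVec_sq] at h
      simp only [φ, Set.indicator_of_mem hA]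
      simp only [mulVec_dotProduct, Matrix.transpose_transpose, NNReal.coe_one, one_mul] at h
      rw [h]
      exact ENNReal.ofReal_le_ofReal hA
    · simp [φ, hA]
  have hout : ∫⁻ A, ∫⁻ g, φ A g ∂(gaussVec (d + 1) 1) ∂(gaussMatrix (d + 1) N v)
      ≤ ENNReal.ofReal T := by
    refine (lintegral_mono hin).trans ?_
    simp
  rw [← key] at hout
  simp only [pow_one, lintegral_dotProduct_self, φ, lintegral_indicator hSm] at hout
  rw [mul_comm, ← ENNReal.le_div_iff_mul_le (Or.inl (by simp)) (Or.inl (by simp)),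
    ← ENNReal.ofReal_natCast, ← ENNReal.ofReal_div_of_pos (by positivity)] at hout
  exact hout

section ConvergenceInProbability

variable {Ω : ℕ → Type*} [∀ N, MeasurableSpace (Ω N)]

/-- The filter on `Σ N, Ω N` of the events whose complements have probability tending to `0`:
convergence along it is convergence in probability. -/
def inProb (μ : ∀ N, Measure (Ω N)) : Filter (Σ N, Ω N) where
  sets := {S | Tendsto (fun N => μ N {ω | ⟨N, ω⟩ ∉ S}) atTop (nhds 0)}
  univ_sets := by simp
  sets_of_superset {S T} hS hST :=
    tendsto_of_tendsto_of_tendsto_of_le_of_le tendsto_const_nhds hS (fun _ => zero_le)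
      (fun _ => measure_mono fun _ hω h => hω (hST h))
  inter_sets {S T} hS hT := by
    have hadd := Tendsto.add hS hT
    rw [add_zero] at hadd
    refine tendsto_of_tendsto_of_tendsto_of_le_of_le tendsto_const_nhds hadd
      (fun _ => zero_le) (fun N => (measure_mono ?_).trans (measure_union_le _ _))
    intro ω hω
    by_contra h
    simp only [Set.mem_union, Set.mem_ofPred_eq, not_or, not_not] at h
    exact hω ⟨h.1, h.2⟩

variable {μ : ∀ N, Measure (Ω N)}

lemma eventually_inProb {p : ∀ N, Ω N → Prop} :
    (∀ᶠ x in inProb μ, p x.1 x.2) ↔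
      Tendsto (fun N => μ N {ω | ¬ p N ω}) atTop (nhds 0) := Iff.rfl

lemma eventually_inProb_of_ae {p : ∀ N, Ω N → Prop}
    (h : ∀ᶠ N in atTop, ∀ᵐ ω ∂μ N, p N ω) : ∀ᶠ x in inProb μ, p x.1 x.2 := by
  rw [eventually_inProb]
  refine tendsto_const_nhds.congr' ?_
  filter_upwards [h] with N hN
  exact (ae_iff.mp hN).symm

lemma tendsto_fst_inProb : Tendsto Sigma.fst (inProb μ) atTop := by
  intro S hS
  refine eventually_inProb_of_ae (p := fun N _ => N ∈ S) ?_
  filter_upwards [hS] with N hN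
  exact Eventually.of_forall fun _ => hN

/-- Chebyshev's inequality as a criterion for convergence in probability. -/
lemma tendsto_inProb_of_lintegral_sq {f : ∀ N, Ω N → ℝ} {a b : ℕ → ℝ} {l : ℝ}
    (hf : ∀ N, Measurable (f N))
    (hle : ∀ᶠ N in atTop,
      ∫⁻ ω, ENNReal.ofReal ((f N ω - a N) ^ 2) ∂μ N ≤ ENNReal.ofReal (b N))
    (ha : Tendsto a atTop (nhds l)) (hb : Tendsto b atTop (nhds 0)) :
    Tendsto (fun x : Σ N, Ω N => f x.1 x.2) (inProb μ) (nhds l) := by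
  have h0 : Tendsto (fun x : Σ N, Ω N => f x.1 x.2 - a x.1) (inProb μ) (nhds 0) := by
    rw [Metric.tendsto_nhds]
    intro ε hε
    refine (eventually_inProb (p := fun N ω => dist (f N ω - a N) 0 < ε)).mpr ?_
    have hε2 : 0 < ε ^ 2 := by positivity
    have hlim : Tendsto (fun N => ENNReal.ofReal (b N / ε ^ 2)) atTop (nhds 0) := by
      have := ENNReal.tendsto_ofReal (hb.div_const (ε ^ 2))
      simpa using this
    refine tendsto_of_tendsto_of_tendsto_of_le_of_le' tendsto_const_nhds hlim
      (Eventually.of_forall fun _ => zero_le) ?_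
    filter_upwards [hle] with N hN
    have hm : Measurable fun ω => ENNReal.ofReal ((f N ω - a N) ^ 2) :=
      (((hf N).sub_const _).pow_const 2).ennreal_ofReal
    have hsub : {ω | ¬ dist (f N ω - a N) 0 < ε}
        ⊆ {ω | ENNReal.ofReal (ε ^ 2) ≤ ENNReal.ofReal ((f N ω - a N) ^ 2)} := by
      intro ω hω
      simp only [Set.mem_ofPred_eq, not_lt, Real.dist_eq, sub_zero] at hω ⊢
      refine ENNReal.ofReal_le_ofReal ?_
      rw [← sq_abs (f N ω - a N)]
      gcongr
    refine (measure_mono hsub).trans ((meas_ge_le_lintegral_div hm.aemeasurable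
      (by simpa using hε.ne') ENNReal.ofReal_ne_top).trans ?_)
    rw [ENNReal.ofReal_div_of_pos hε2]
    gcongr
  have := h0.add (ha.comp tendsto_fst_inProb)
  simpa using this

/-- Convergence in probability with a bounded second moment implies convergence of the means. -/
lemma tendsto_integral_of_tendsto_inProb [∀ N, IsProbabilityMeasure (μ N)] {f : ∀ N, Ω N → ℝ}
    {l C : ℝ} (hf : ∀ N, Measurable (f N))
    (hlim : Tendsto (fun x : Σ N, Ω N => f x.1 x.2) (inProb μ) (nhds l))
    (hC : ∀ᶠ N in atTop, ∫⁻ ω, ENNReal.ofReal ((f N ω) ^ 2) ∂μ N ≤ ENNReal.ofReal C) :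
    Tendsto (fun N => ∫ ω, f N ω ∂μ N) atTop (nhds l) := by
  have hInt : ∀ᶠ N in atTop, Integrable (fun ω => (f N ω) ^ 2) (μ N) := by
    filter_upwards [hC] with N hN
    refine ⟨((hf N).pow_const 2).aestronglyMeasurable, ?_⟩
    rw [hasFiniteIntegral_iff_ofReal (Eventually.of_forall fun _ => sq_nonneg _)]
    exact hN.trans_lt ENNReal.ofReal_lt_top
  have hsq : ∀ᶠ N in atTop, ∫ ω, (f N ω) ^ 2 ∂μ N ≤ max C 0 := by
    filter_upwards [hC] with N hN
    rw [integral_eq_lintegral_of_nonneg_ae (Eventually.of_forall fun _ => sq_nonneg _)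
      ((hf N).pow_const 2).aestronglyMeasurable]
    refine (ENNReal.toReal_mono ENNReal.ofReal_ne_top hN).trans ?_
    rw [ENNReal.toReal_ofReal']
  set C' : ℝ := 2 * max C 0 + 2 * l ^ 2 + 1 with hC'
  have hC'0 : 0 < C' := by positivity
  rw [Metric.tendsto_nhds]
  intro ε hε
  set T : ℝ := 4 * C' / ε with hT
  have hT0 : 0 < T := by positivity
  have hev := (Metric.tendsto_nhds.mp hlim) (ε / 4) (by positivity)
  replace hev := (eventually_inProb (p := fun N ω => dist (f N ω) l < ε / 4)).mp hev
  have hprob : ∀ᶠ N in atTop, μ N {ω | ¬ dist (f N ω) l < ε / 4} < ENNReal.ofReal (ε / (4 * T)) :=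
    hev.eventually_lt_const (by simp; positivity)
  filter_upwards [hprob, hInt, hsq] with N hp hi hs
  set B : Set (Ω N) := {ω | ¬ dist (f N ω) l < ε / 4} with hB
  have hBm : MeasurableSet B := (measurableSet_lt ((hf N).dist measurable_const)
    measurable_const).compl
  have hi1 : Integrable (f N) (μ N) :=
    ((memLp_two_iff_integrable_sq (hf N).aestronglyMeasurable).mpr hi).integrable one_le_two
  have hpt : ∀ ω, |f N ω - l| ≤ ε / 4 + B.indicator (fun _ => T) ω + (2 * f N ω ^ 2 + 2 * l ^ 2) / T := by
    intro ω
    have hn : 0 ≤ (2 * f N ω ^ 2 + 2 * l ^ 2) / T := by positivity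
    by_cases hω : ω ∈ B
    · rw [Set.indicator_of_mem hω]
      by_cases hle : |f N ω - l| ≤ T
      · linarith
      · push Not at hle
        have : |f N ω - l| ≤ (2 * f N ω ^ 2 + 2 * l ^ 2) / T := by
          rw [le_div_iff₀ hT0]
          have h1 : |f N ω - l| * T ≤ |f N ω - l| ^ 2 := by nlinarith
          rw [sq_abs] at h1
          nlinarith [sq_nonneg (f N ω + l)]
        linarith
    · rw [Set.indicator_of_notMem hω]
      have : dist (f N ω) l < ε / 4 := by simpa [hB] using hω
      rw [Real.dist_eq] at this
      linarith
  have hindic : Integrable (B.indicator (fun _ => T)) (μ N) :=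
    (integrable_const T).indicator hBm
  have hquad : Integrable (fun ω => (2 * f N ω ^ 2 + 2 * l ^ 2) / T) (μ N) :=
    ((hi.const_mul 2).add (integrable_const _)).div_const T
  have hbound : ∫ ω, |f N ω - l| ∂μ N ≤
      ε / 4 + (μ N).real B * T + (2 * (∫ ω, f N ω ^ 2 ∂μ N) + 2 * l ^ 2) / T := by
    refine (integral_mono (hi1.sub (integrable_const l)).abs
      (((integrable_const (ε / 4)).add hindic).add hquad) hpt).trans (le_of_eq ?_)
    rw [integral_add' ((integrable_const _).add hindic) hquad, integral_add' (integrable_const _)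
      hindic, integral_indicator hBm, setIntegral_const, integral_div T,
      integral_add (hi.const_mul 2) (integrable_const _), integral_const_mul]
    simp
  have h1 : (μ N).real B * T < ε / 4 := by
    have : (μ N).real B < ε / (4 * T) :=
      (ENNReal.toReal_lt_of_lt_ofReal hp)
    calc (μ N).real B * T < ε / (4 * T) * T := by gcongr
      _ = ε / 4 := by field_simp
  have h2 : (2 * (∫ ω, f N ω ^ 2 ∂μ N) + 2 * l ^ 2) / T ≤ ε / 4 := by
    rw [div_le_iff₀ hT0, hT]
    have : ε / 4 * (4 * C' / ε) = C' := by field_simp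
    rw [this]; linarith
  have h3 : |∫ ω, f N ω ∂μ N - l| ≤ ∫ ω, |f N ω - l| ∂μ N := by
    have : ∫ ω, f N ω ∂μ N - l = ∫ ω, (f N ω - l) ∂μ N := by
      rw [integral_sub hi1 (integrable_const l)]; simp
    rw [this]; exact abs_integral_le_integral_abs
  rw [Real.dist_eq]
  linarith

end ConvergenceInProbability

section Limits

/-- A family of symmetric matrices whose quadratic forms converge to a constant on the unit sphere
converges to a multiple of the identity. -/
lemma tendsto_smul_one_of_quadForm {α : Type*} {l : Filter α} {r : ℕ}
    {M : α → Matrix (Fin r) (Fin r) ℝ} (hM : ∀ a, (M a).IsSymm) {t : ℝ}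
    (h : ∀ x : Fin r → ℝ, x ⬝ᵥ x = 1 → Tendsto (fun a => x ⬝ᵥ M a *ᵥ x) l (nhds t)) :
    Tendsto M l (nhds (t • 1)) := by
  have hform : ∀ a i j, (Pi.single i 1 : Fin r → ℝ) ⬝ᵥ M a *ᵥ Pi.single j 1 = M a i j :=
    fun a i j => by simp
  have hdiag : ∀ i, Tendsto (fun a => M a i i) l (nhds t) := fun i => by
    simpa only [hform] using h (Pi.single i 1) (by simp)
  refine tendsto_pi_nhds.mpr fun i => tendsto_pi_nhds.mpr fun j => ?_
  by_cases hij : i = j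
  · subst hij
    simpa using hdiag i
  · have hs : (√2)⁻¹ * (√2)⁻¹ = (2 : ℝ)⁻¹ := by
      rw [← mul_inv, Real.mul_self_sqrt zero_le_two]
    have hji : j ≠ i := fun h => hij h.symm
    have hx := h ((√2)⁻¹ • (Pi.single i 1 + Pi.single j 1)) (by
      simp only [smul_dotProduct, dotProduct_smul, dotProduct_add, add_dotProduct, smul_eq_mul]
      simp only [dotProduct_single, Pi.single_apply, hij, hji, if_true, if_false]
      linear_combination 2 * hs)
    have heq : ∀ a, M a i j = ((√2)⁻¹ • (Pi.single i 1 + Pi.single j 1)) ⬝ᵥ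
        M a *ᵥ ((√2)⁻¹ • (Pi.single i 1 + Pi.single j 1)) - (M a i i + M a j j) / 2 := fun a => by
      have hsym : M a j i = M a i j := (hM a).apply i j
      simp only [Matrix.mulVec_smul, Matrix.mulVec_add, smul_dotProduct, dotProduct_smul,
        dotProduct_add, add_dotProduct, smul_eq_mul, hform, hsym]
      linear_combination -(M a i i + 2 * M a i j + M a j j) * hs
    have := hx.sub (((hdiag i).add (hdiag j)).div_const 2)
    simp only [← heq] at this
    simpa [hij] using this

variable {η c : ℝ} {r : ℕ} {d : ℕ → ℕ}

lemma tendsto_natCast_div (hdc : Tendsto (fun N : ℕ => (d N : ℝ) / N) atTop (nhds c))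
    (hc : 1 < c) : Tendsto (fun N : ℕ => (N : ℝ) / d N) atTop (nhds (1 / c)) := by
  have := hdc.inv₀ (by positivity)
  simpa using this

lemma eventually_lt_dim (hdc : Tendsto (fun N : ℕ => (d N : ℝ) / N) atTop (nhds c))
    (hc : 1 < c) : ∀ᶠ N in atTop, N < d N := by
  filter_upwards [hdc.eventually_const_lt hc, eventually_gt_atTop 0] with N hN hN0
  have : (0 : ℝ) < N := by exact_mod_cast hN0
  rw [lt_div_iff₀ this, one_mul] at hN
  exact_mod_cast hN

lemma tendsto_dim (hdc : Tendsto (fun N : ℕ => (d N : ℝ) / N) atTop (nhds c))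
    (hc : 1 < c) : Tendsto (fun N => (d N : ℝ)) atTop atTop := by
  refine tendsto_atTop_mono' _ ?_ tendsto_natCast_atTop_atTop
  filter_upwards [eventually_lt_dim hdc hc] with N hN
  exact_mod_cast hN.le

/-- The variance `η² / d` of the entries. -/
noncomputable def entryVar (η : ℝ) (d : ℕ) : NNReal := (η ^ 2 / (d : ℝ)).toNNReal

lemma coe_entryVar (η : ℝ) (d : ℕ) : (entryVar η d : ℝ) = η ^ 2 / d :=
  Real.coe_toNNReal _ (by positivity)

lemma entryVar_ne_zero (hη : 0 < η) {d : ℕ} (hd : 0 < d) : entryVar η d ≠ 0 := by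
  have : (0 : ℝ) < d := by exact_mod_cast hd
  rw [← NNReal.coe_ne_zero, coe_entryVar]
  positivity

/-- The laws of the matrices `A_N`. -/
noncomputable abbrev gaussLaw (η : ℝ) (d : ℕ → ℕ) (N : ℕ) : Measure (Matrix (Fin (d N)) (Fin N) ℝ) :=
  gaussMatrix (d N) N (entryVar η (d N))

/-- Convergence of the inverse Gram form along unit vectors. -/
lemma tendsto_gram_inv_form (hη : 0 < η) (hd : ∀ N, 0 < d N)
    (hdc : Tendsto (fun N : ℕ => (d N : ℝ) / N) atTop (nhds c)) (hc : 1 < c)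
    {y : ∀ N, Fin N → ℝ} (hy : ∀ᶠ N in atTop, y N ⬝ᵥ y N = 1) :
    Tendsto (fun p : Σ N, Matrix (Fin (d N)) (Fin N) ℝ => y p.1 ⬝ᵥ (p.2ᵀ * p.2)⁻¹ *ᵥ y p.1)
      (inProb (gaussLaw η d)) (nhds (η ^ 2 * (1 - 1 / c))⁻¹) := by
  have hc0 : 0 < 1 - 1 / c := by
    rw [sub_pos, div_lt_one (by positivity)]; exact hc
  have hinvd := (tendsto_dim hdc hc).inv_tendsto_atTop
  have ha : Tendsto (fun N => (entryVar η (d N) : ℝ) * (d N - N + 1)) atTop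
      (nhds (η ^ 2 * (1 - 1 / c))) := by
    have h := ((((tendsto_const_nhds (x := (1 : ℝ))).sub (tendsto_natCast_div hdc hc)).add
      hinvd).const_mul (η ^ 2))
    rw [add_zero] at h
    refine h.congr fun N => ?_
    have : (0 : ℝ) < d N := by exact_mod_cast hd N
    rw [coe_entryVar, Pi.inv_apply]
    field_simp
  have hb : Tendsto (fun N => gaussSqVar * (entryVar η (d N) : ℝ) ^ 2 * (d N - N + 1)) atTop
      (nhds 0) := by
    have h := (ha.mul (hinvd.const_mul (η ^ 2))).const_mul gaussSqVar
    simp only [mul_zero] at h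
    refine h.congr fun N => ?_
    rw [coe_entryVar, Pi.inv_apply]
    ring
  have h := tendsto_inProb_of_lintegral_sq (μ := gaussLaw η d)
    (f := fun N A => (y N ⬝ᵥ (Aᵀ * A)⁻¹ *ᵥ y N)⁻¹)
    (fun N => (measurable_gram_inv_form (y N)).inv) (by
      filter_upwards [hy, eventually_lt_dim hdc hc] with N hyN hN
      exact (lintegral_inv_gram_inv_form (entryVar_ne_zero hη (hd N)) hN.le hyN).le) ha hb
  simpa using h.inv₀ (by positivity)

/-- Convergence of the projection form along unit vectors. -/
lemma tendsto_proj_form (hη : 0 < η) (hd : ∀ N, 0 < d N)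
    (hdc : Tendsto (fun N : ℕ => (d N : ℝ) / N) atTop (nhds c)) (hc : 1 < c)
    {u : ∀ N, Fin (d N) → ℝ} (hu : ∀ᶠ N in atTop, u N ⬝ᵥ u N = 1) :
    Tendsto (fun p : Σ N, Matrix (Fin (d N)) (Fin N) ℝ => u p.1 ⬝ᵥ (p.2 * pinv p.2) *ᵥ u p.1)
      (inProb (gaussLaw η d)) (nhds (1 / c)) := by
  refine tendsto_inProb_of_lintegral_sq (μ := gaussLaw η d)
    (f := fun N A => u N ⬝ᵥ (A * pinv A) *ᵥ u N) (b := fun N => gaussSqVar / d N)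
    (fun N => measurable_proj_form.comp (measurable_id.prodMk measurable_const)) ?_
    (tendsto_natCast_div hdc hc) ((tendsto_dim hdc hc).const_div_atTop _)
  filter_upwards [hu, eventually_lt_dim hdc hc] with N huN hN
  exact lintegral_proj_form_le (entryVar_ne_zero hη (hd N)) hN.le huN

/-- The bilinear form of the pseudoinverse along unit vectors tends to `0`. -/
lemma tendsto_pinv_form (hη : 0 < η) (hd : ∀ N, 0 < d N)
    (hdc : Tendsto (fun N : ℕ => (d N : ℝ) / N) atTop (nhds c)) (hc : 1 < c)
    {y : ∀ N, Fin N → ℝ} (hy : ∀ᶠ N in atTop, y N ⬝ᵥ y N = 1)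
    {u : ∀ N, Fin (d N) → ℝ} (hu : ∀ᶠ N in atTop, u N ⬝ᵥ u N = 1) :
    Tendsto (fun p : Σ N, Matrix (Fin (d N)) (Fin N) ℝ => y p.1 ⬝ᵥ pinv p.2 *ᵥ u p.1)
      (inProb (gaussLaw η d)) (nhds 0) := by
  set T : ℝ := (η ^ 2 * (1 - 1 / c))⁻¹ + 1
  let B : ∀ N, Set (Matrix (Fin (d N)) (Fin N) ℝ) := fun N => {A | y N ⬝ᵥ (Aᵀ * A)⁻¹ *ᵥ y N ≤ T}
  have hBm : ∀ N, MeasurableSet (B N) := fun N => measurable_gram_inv_form (y N) measurableSet_Iic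
  have hm : ∀ N, Measurable fun A : Matrix (Fin (d N)) (Fin N) ℝ => y N ⬝ᵥ pinv A *ᵥ u N :=
    fun N => measurable_const.matrix_dotProduct
      (measurable_id.matrix_pinv.matrix_mulVec measurable_const)
  have h := tendsto_inProb_of_lintegral_sq (μ := gaussLaw η d) (a := fun _ => 0)
    (f := fun N => (B N).indicator fun A => y N ⬝ᵥ pinv A *ᵥ u N) (b := fun N => T / d N)
    (fun N => (hm N).indicator (hBm N)) (by
      filter_upwards [hu] with N huN
      refine le_trans (le_of_eq ?_) (lintegral_pinv_form_le (entryVar η (d N)) huN (y N) T)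
      rw [← lintegral_indicator (hBm N)]
      refine lintegral_congr fun A => ?_
      by_cases hA : A ∈ B N
      · simp [hA]
      · simp [hA]) tendsto_const_nhds ((tendsto_dim hdc hc).const_div_atTop _)
  refine h.congr' ?_
  filter_upwards [(tendsto_gram_inv_form hη hd hdc hc hy).eventually_lt_const
    (lt_add_one (η ^ 2 * (1 - 1 / c))⁻¹)] with p hp
  exact Set.indicator_of_mem (s := B p.1) hp.le _

end Limits

section Domination

variable {d N r : ℕ}

lemma K1mat_eq (A : Matrix (Fin d) (Fin N) ℝ) (U : Matrix (Fin d) (Fin r) ℝ)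
    (V : Matrix (Fin N) (Fin r) ℝ) (S : Matrix (Fin r) (Fin r) ℝ) :
    K1mat A U V S = Hmat A V * (Hmat A V)ᵀ + (Zmat A U V S * pinv (Pmat A U S)) *
      (Zmat A U V S * pinv (Pmat A U S))ᵀ := by
  rw [K1mat, ← pinv_mul_transpose_pinv, Matrix.transpose_mul]
  simp only [Matrix.mul_assoc]

lemma K1mat_inv_form {A : Matrix (Fin d) (Fin N) ℝ} (hA : IsUnit (Aᵀ * A).det)
    (U : Matrix (Fin d) (Fin r) ℝ) {V : Matrix (Fin N) (Fin r) ℝ} (hV : Vᵀ * V = 1)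
    (S : Matrix (Fin r) (Fin r) ℝ) (x : Fin r → ℝ) :
    0 ≤ x ⬝ᵥ (K1mat A U V S)⁻¹ *ᵥ x ∧
      x ⬝ᵥ (K1mat A U V S)⁻¹ *ᵥ x ≤ (A *ᵥ V *ᵥ x) ⬝ᵥ (A *ᵥ V *ᵥ x) := by
  have hnn : ∀ {n : ℕ} (z : Fin n → ℝ), 0 ≤ z ⬝ᵥ z := fun z =>
    Finset.sum_nonneg fun i _ => mul_self_nonneg (z i)
  by_cases hK : IsUnit (K1mat A U V S).det
  swap
  · rw [Matrix.nonsing_inv_apply_not_isUnit _ hK, Matrix.zero_mulVec, dotProduct_zero]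
    exact ⟨le_rfl, hnn _⟩
  set y := (K1mat A U V S)⁻¹ *ᵥ x with hy
  have hKy : K1mat A U V S *ᵥ y = x := by
    rw [hy, Matrix.mulVec_mulVec, Matrix.mul_nonsing_inv _ hK, Matrix.one_mulVec]
  set h := (Hmat A V)ᵀ *ᵥ y with hh
  have hq : h ⬝ᵥ h ≤ x ⬝ᵥ y := by
    have h1 : x ⬝ᵥ y = h ⬝ᵥ h + ((Zmat A U V S * pinv (Pmat A U S))ᵀ *ᵥ y) ⬝ᵥ
        ((Zmat A U V S * pinv (Pmat A U S))ᵀ *ᵥ y) := by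
      conv_lhs => rw [← hKy]
      rw [dotProduct_comm, K1mat_eq, Matrix.add_mulVec, dotProduct_add, hh,
        mulVec_dotProduct_mulVec, mulVec_dotProduct_mulVec, Matrix.transpose_transpose,
        Matrix.transpose_transpose]
    rw [h1]
    exact le_add_of_nonneg_right (hnn _)
  have hxy : x ⬝ᵥ y = (A *ᵥ V *ᵥ x) ⬝ᵥ h := by
    have h2 : Vᵀ * (Aᵀ * (Hmat A V)ᵀ) = 1 := by
      have h3 : Hmat A V * A * V = 1 := by
        rw [Hmat, Matrix.mul_assoc Vᵀ, pinv_mul_self hA, Matrix.mul_one, hV]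
      have := congrArg Matrix.transpose h3
      simpa [Matrix.transpose_mul] using this
    rw [hh, mulVec_dotProduct, mulVec_dotProduct, Matrix.mulVec_mulVec, Matrix.mulVec_mulVec,
      Matrix.mul_assoc, h2, Matrix.one_mulVec]
  have hCS : ((A *ᵥ V *ᵥ x) ⬝ᵥ h) ^ 2
      ≤ ((A *ᵥ V *ᵥ x) ⬝ᵥ (A *ᵥ V *ᵥ x)) * (h ⬝ᵥ h) := by
    have := Finset.sum_mul_sq_le_sq_mul_sq Finset.univ (A *ᵥ V *ᵥ x) h
    simpa only [dotProduct, ← pow_two] using this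
  rw [← hxy] at hCS
  have h0 : 0 ≤ x ⬝ᵥ y := (hnn h).trans hq
  refine ⟨h0, ?_⟩
  rcases h0.eq_or_lt with h0 | h0
  · rw [← h0]; exact hnn _
  · have h4 : (x ⬝ᵥ y) ^ 2 ≤ ((A *ᵥ V *ᵥ x) ⬝ᵥ (A *ᵥ V *ᵥ x)) * (x ⬝ᵥ y) :=
      hCS.trans (mul_le_mul_of_nonneg_left hq (hnn _))
    rw [pow_two] at h4
    exact le_of_mul_le_mul_right h4 h0

lemma K1mat_isSymm (A : Matrix (Fin d) (Fin N) ℝ) (U : Matrix (Fin d) (Fin r) ℝ)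
    (V : Matrix (Fin N) (Fin r) ℝ) (S : Matrix (Fin r) (Fin r) ℝ) : (K1mat A U V S).IsSymm := by
  rw [Matrix.IsSymm, K1mat_eq]
  simp only [Matrix.transpose_add, Matrix.transpose_mul, Matrix.transpose_transpose]

/-- Each entry of `K₁⁻¹` is dominated by the squared norms of two columns of `A V`. -/
lemma abs_K1mat_inv_le {A : Matrix (Fin d) (Fin N) ℝ} (hA : IsUnit (Aᵀ * A).det)
    (U : Matrix (Fin d) (Fin r) ℝ) {V : Matrix (Fin N) (Fin r) ℝ} (hV : Vᵀ * V = 1)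
    (S : Matrix (Fin r) (Fin r) ℝ) (i j : Fin r) :
    2 * |(K1mat A U V S)⁻¹ i j| ≤
      (A *ᵥ V *ᵥ Pi.single i 1) ⬝ᵥ (A *ᵥ V *ᵥ Pi.single i 1) +
      (A *ᵥ V *ᵥ Pi.single j 1) ⬝ᵥ (A *ᵥ V *ᵥ Pi.single j 1) := by
  obtain ⟨hp0, hp1⟩ := K1mat_inv_form hA U hV S (Pi.single i 1 + Pi.single j 1)
  obtain ⟨hm0, hm1⟩ := K1mat_inv_form hA U hV S (Pi.single i 1 - Pi.single j 1)
  have hsym : (K1mat A U V S)⁻¹ j i = (K1mat A U V S)⁻¹ i j := by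
    have : ((K1mat A U V S)⁻¹).IsSymm := by
      rw [Matrix.IsSymm, Matrix.transpose_nonsing_inv, (K1mat_isSymm A U V S).eq]
    exact this.apply i j
  set X := (K1mat A U V S)⁻¹
  have hform : ∀ i j, (Pi.single i 1 : Fin r → ℝ) ⬝ᵥ X *ᵥ Pi.single j 1 = X i j :=
    fun i j => by simp
  have hcomm := dotProduct_comm (A *ᵥ V *ᵥ Pi.single j 1) (A *ᵥ V *ᵥ Pi.single i 1)
  simp only [Matrix.mulVec_add, Matrix.mulVec_sub, dotProduct_add, add_dotProduct, dotProduct_sub,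
    sub_dotProduct, hform, hsym, hcomm] at hp0 hp1 hm0 hm1
  rw [← abs_two, ← abs_mul, abs_le]
  constructor <;> linarith

lemma measurable_K1mat_inv (U : Matrix (Fin d) (Fin r) ℝ)
    (V : Matrix (Fin N) (Fin r) ℝ) (S : Matrix (Fin r) (Fin r) ℝ) (i j : Fin r) :
    Measurable fun A : Matrix (Fin d) (Fin N) ℝ => (K1mat A U V S)⁻¹ i j := by
  have hA : Measurable fun A : Matrix (Fin d) (Fin N) ℝ => A := measurable_id
  have hadd : ∀ {m n : ℕ} {f g : Matrix (Fin d) (Fin N) ℝ → Matrix (Fin m) (Fin n) ℝ},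
      Measurable f → Measurable g → Measurable fun A => f A + g A := by
    intro m n f g hf hg
    exact (continuous_add (M := Matrix (Fin m) (Fin n) ℝ)).measurable.comp (hf.prodMk hg)
  have hneg : ∀ {m n : ℕ} {f : Matrix (Fin d) (Fin N) ℝ → Matrix (Fin m) (Fin n) ℝ},
      Measurable f → Measurable fun A => -f A := by
    intro m n f hf
    exact (continuous_neg (G := Matrix (Fin m) (Fin n) ℝ)).measurable.comp hf
  have hH : Measurable fun A : Matrix (Fin d) (Fin N) ℝ => Hmat A V :=
    measurable_const.matrix_mul hA.matrix_pinv
  have hZ : Measurable fun A : Matrix (Fin d) (Fin N) ℝ => Zmat A U V S :=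
    hadd measurable_const ((hH.matrix_mul measurable_const).matrix_mul measurable_const)
  have hP : Measurable fun A : Matrix (Fin d) (Fin N) ℝ => Pmat A U S := by
    simp only [Pmat, sub_eq_add_neg]
    exact ((hneg (hadd measurable_const (hneg (hA.matrix_mul hA.matrix_pinv)))).matrix_mul
      measurable_const).matrix_mul measurable_const
  have hK : Measurable fun A : Matrix (Fin d) (Fin N) ℝ => K1mat A U V S :=
    hadd (hH.matrix_mul hH.matrix_transpose) ((hZ.matrix_mul
      (hP.matrix_transpose.matrix_mul hP).matrix_inv).matrix_mul hZ.matrix_transpose)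
  exact (measurable_entry i j).comp hK.matrix_inv

/-- A fourth-moment bound for `A y`. -/
lemma lintegral_mulVec_fourth_le (η : ℝ) (hd : 0 < d) {y : Fin N → ℝ} (hy : y ⬝ᵥ y = 1) :
    ∫⁻ A, ENNReal.ofReal (((A *ᵥ y) ⬝ᵥ (A *ᵥ y)) ^ 2) ∂(gaussMatrix d N (entryVar η d))
      ≤ ENNReal.ofReal (2 * (gaussSqVar * η ^ 4) + 2 * η ^ 4) := by
  have hd' : (1 : ℝ) ≤ d := by exact_mod_cast hd
  have hvd : (entryVar η d : ℝ) * d = η ^ 2 := by rw [coe_entryVar]; field_simp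
  have h := lintegral_mulVec_sq (d := d) (entryVar η d) hy
  rw [hvd] at h
  have hm : Measurable fun A : Matrix (Fin d) (Fin N) ℝ =>
      ENNReal.ofReal (((A *ᵥ y) ⬝ᵥ (A *ᵥ y) - η ^ 2) ^ 2) := by
    have h1 : Measurable fun A : Matrix (Fin d) (Fin N) ℝ => A *ᵥ y :=
      measurable_id.matrix_mulVec measurable_const
    exact (((h1.matrix_dotProduct h1).sub_const _).pow_const 2).ennreal_ofReal
  have hκ := gaussSqVar_nonneg
  calc ∫⁻ A, ENNReal.ofReal (((A *ᵥ y) ⬝ᵥ (A *ᵥ y)) ^ 2) ∂(gaussMatrix d N (entryVar η d))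
      ≤ ∫⁻ A, (ENNReal.ofReal 2 * ENNReal.ofReal (((A *ᵥ y) ⬝ᵥ (A *ᵥ y) - η ^ 2) ^ 2) +
          ENNReal.ofReal (2 * η ^ 4)) ∂(gaussMatrix d N (entryVar η d)) := by
        refine lintegral_mono fun A => ?_
        rw [← ENNReal.ofReal_mul zero_le_two, ← ENNReal.ofReal_add (by positivity) (by positivity)]
        refine ENNReal.ofReal_le_ofReal ?_
        nlinarith [sq_nonneg ((A *ᵥ y) ⬝ᵥ (A *ᵥ y) - 2 * η ^ 2)]
    _ = ENNReal.ofReal (2 * (gaussSqVar * (entryVar η d : ℝ) ^ 2 * d) + 2 * η ^ 4) := by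
        rw [lintegral_add_right _ measurable_const, lintegral_const_mul _ hm, h, lintegral_const,
          measure_univ, mul_one, ← ENNReal.ofReal_mul zero_le_two,
          ← ENNReal.ofReal_add (by positivity) (by positivity)]
    _ ≤ _ := by
        refine ENNReal.ofReal_le_ofReal ?_
        have h2 : (entryVar η d : ℝ) ^ 2 * d ≤ η ^ 4 := by
          have : (entryVar η d : ℝ) ^ 2 * d = η ^ 4 / d := by
            rw [coe_entryVar]; field_simp
          rw [this]
          exact div_le_self (by positivity) hd'
        have h3 := mul_le_mul_of_nonneg_left h2 hκ
        rw [mul_assoc gaussSqVar]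
        linarith

/-- A uniform second-moment bound for the entries of `K₁⁻¹`. -/
lemma lintegral_K1mat_inv_sq_le {η : ℝ} (hη : 0 < η) (hd : 0 < d) (hN : N ≤ d)
    (U : Matrix (Fin d) (Fin r) ℝ) {V : Matrix (Fin N) (Fin r) ℝ} (hV : Vᵀ * V = 1)
    (S : Matrix (Fin r) (Fin r) ℝ) (i j : Fin r) :
    ∫⁻ A, ENNReal.ofReal (((K1mat A U V S)⁻¹ i j) ^ 2) ∂(gaussMatrix d N (entryVar η d))
      ≤ ENNReal.ofReal (2 * (2 * (gaussSqVar * η ^ 4) + 2 * η ^ 4)) := by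
  have hunit : ∀ i : Fin r, (V *ᵥ Pi.single i 1) ⬝ᵥ (V *ᵥ Pi.single i 1) = 1 := fun i => by
    rw [mulVec_dotProduct_mulVec, hV]; simp
  have hκ := gaussSqVar_nonneg
  have hm : Measurable fun A : Matrix (Fin d) (Fin N) ℝ =>
      ENNReal.ofReal (((A *ᵥ V *ᵥ Pi.single j 1) ⬝ᵥ (A *ᵥ V *ᵥ Pi.single j 1)) ^ 2) := by
    have h1 : Measurable fun A : Matrix (Fin d) (Fin N) ℝ => A *ᵥ V *ᵥ Pi.single j 1 :=
      measurable_id.matrix_mulVec measurable_const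
    exact ((h1.matrix_dotProduct h1).pow_const 2).ennreal_ofReal
  calc ∫⁻ A, ENNReal.ofReal (((K1mat A U V S)⁻¹ i j) ^ 2) ∂(gaussMatrix d N (entryVar η d))
      ≤ ∫⁻ A, (ENNReal.ofReal
            (((A *ᵥ V *ᵥ Pi.single i 1) ⬝ᵥ (A *ᵥ V *ᵥ Pi.single i 1)) ^ 2) +
          ENNReal.ofReal (((A *ᵥ V *ᵥ Pi.single j 1) ⬝ᵥ (A *ᵥ V *ᵥ Pi.single j 1)) ^ 2))
          ∂(gaussMatrix d N (entryVar η d)) := by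
        refine lintegral_mono_ae ?_
        filter_upwards [ae_isUnit_gram (entryVar_ne_zero hη hd) hN] with A hA
        rw [← ENNReal.ofReal_add (by positivity) (by positivity)]
        refine ENNReal.ofReal_le_ofReal ?_
        have h := abs_K1mat_inv_le hA U hV S i j
        rw [← sq_abs]
        set a := (A *ᵥ V *ᵥ Pi.single i 1) ⬝ᵥ (A *ᵥ V *ᵥ Pi.single i 1)
        set b := (A *ᵥ V *ᵥ Pi.single j 1) ⬝ᵥ (A *ᵥ V *ᵥ Pi.single j 1)
        have h0 := abs_nonneg ((K1mat A U V S)⁻¹ i j)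
        nlinarith [sq_nonneg (a - b)]
    _ ≤ _ := by
        rw [lintegral_add_right _ hm, two_mul (2 * (gaussSqVar * η ^ 4) + 2 * η ^ 4),
          ENNReal.ofReal_add (by positivity) (by positivity)]
        exact add_le_add (lintegral_mulVec_fourth_le η hd (hunit i))
          (lintegral_mulVec_fourth_le η hd (hunit j))

end Domination

section Assembly

variable {η c : ℝ} {r : ℕ} {d : ℕ → ℕ}

lemma Pmat_gram {d N : ℕ} (A : Matrix (Fin d) (Fin N) ℝ) {U : Matrix (Fin d) (Fin r) ℝ}
    (hU : Uᵀ * U = 1) (S : Matrix (Fin r) (Fin r) ℝ) :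
    (Pmat A U S)ᵀ * Pmat A U S = Sᵀ * (1 - Uᵀ * (A * pinv A) * U) * S := by
  have hP : Pmat A U S = -(coproj A * U * S) := by
    rw [Pmat, coproj, Matrix.neg_mul, Matrix.neg_mul]
  calc (Pmat A U S)ᵀ * Pmat A U S
      = Sᵀ * (Uᵀ * (coproj A * coproj A) * U) * S := by
        rw [hP, Matrix.transpose_neg, Matrix.neg_mul, Matrix.mul_neg, neg_neg,
          Matrix.transpose_mul, Matrix.transpose_mul, (coproj_isSymm A).eq]
        simp only [Matrix.mul_assoc]
    _ = _ := by
        rw [coproj_idem, coproj, Matrix.mul_sub, Matrix.sub_mul, Matrix.mul_one, hU]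

lemma tendsto_matrix_inv {α : Type*} {l : Filter α} {M : α → Matrix (Fin r) (Fin r) ℝ}
    {L : Matrix (Fin r) (Fin r) ℝ} (h : Tendsto M l (nhds L)) (hL : IsUnit L.det) :
    Tendsto (fun a => (M a)⁻¹) l (nhds L⁻¹) := by
  refine (continuousAt_matrix_inv L ?_).tendsto.comp h
  rw [Ring.inverse_eq_inv']
  exact continuousAt_inv₀ hL.ne_zero

lemma eventually_mulVec_unit {m : ℕ → ℕ} {W : ∀ N, Matrix (Fin (m N)) (Fin r) ℝ}
    (hW : ∀ᶠ N in atTop, (W N)ᵀ * W N = 1) {x : Fin r → ℝ} (hx : x ⬝ᵥ x = 1) :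
    ∀ᶠ N in atTop, (W N *ᵥ x) ⬝ᵥ (W N *ᵥ x) = 1 := by
  filter_upwards [hW] with N hN
  rw [mulVec_dotProduct_mulVec, hN, Matrix.one_mulVec, hx]

lemma tendsto_Hmat_gram (hη : 0 < η) (hd : ∀ N, 0 < d N)
    (hdc : Tendsto (fun N : ℕ => (d N : ℝ) / N) atTop (nhds c)) (hc : 1 < c)
    {V : ∀ N, Matrix (Fin N) (Fin r) ℝ} (hV : ∀ᶠ N in atTop, (V N)ᵀ * V N = 1) :
    Tendsto (fun p : Σ N, Matrix (Fin (d N)) (Fin N) ℝ => Hmat p.2 (V p.1) * (Hmat p.2 (V p.1))ᵀ)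
      (inProb (gaussLaw η d)) (nhds ((η ^ 2 * (1 - 1 / c))⁻¹ • 1)) := by
  have heq : ∀ p : Σ N, Matrix (Fin (d N)) (Fin N) ℝ,
      Hmat p.2 (V p.1) * (Hmat p.2 (V p.1))ᵀ = (V p.1)ᵀ * ((p.2ᵀ * p.2)⁻¹ * V p.1) := fun p => by
    rw [Hmat, Matrix.transpose_mul, Matrix.transpose_transpose, ← pinv_mul_transpose_pinv]
    simp only [Matrix.mul_assoc]
  refine tendsto_smul_one_of_quadForm (fun p => ?_) fun x hx => ?_
  · rw [Matrix.IsSymm, Matrix.transpose_mul, Matrix.transpose_transpose]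
  · refine (tendsto_gram_inv_form hη hd hdc hc (eventually_mulVec_unit hV hx)).congr fun p => ?_
    rw [heq, mulVec_dotProduct, Matrix.mulVec_mulVec, Matrix.mulVec_mulVec, Matrix.mul_assoc]

lemma tendsto_proj_compression (hη : 0 < η) (hd : ∀ N, 0 < d N)
    (hdc : Tendsto (fun N : ℕ => (d N : ℝ) / N) atTop (nhds c)) (hc : 1 < c)
    {U : ∀ N, Matrix (Fin (d N)) (Fin r) ℝ} (hU : ∀ᶠ N in atTop, (U N)ᵀ * U N = 1) :
    Tendsto (fun p : Σ N, Matrix (Fin (d N)) (Fin N) ℝ =>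
        (U p.1)ᵀ * (p.2 * pinv p.2) * U p.1)
      (inProb (gaussLaw η d)) (nhds ((1 / c) • 1)) := by
  refine tendsto_smul_one_of_quadForm (fun p => ?_) fun x hx => ?_
  · rw [Matrix.IsSymm, Matrix.transpose_mul, Matrix.transpose_mul, Matrix.transpose_transpose,
      transpose_mul_pinv, ← Matrix.mul_assoc]
  · refine (tendsto_proj_form hη hd hdc hc (eventually_mulVec_unit hU hx)).congr fun p => ?_
    rw [mulVec_dotProduct, Matrix.mulVec_mulVec, Matrix.mulVec_mulVec, ← Matrix.mul_assoc]

lemma tendsto_pinv_compression (hη : 0 < η) (hd : ∀ N, 0 < d N)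
    (hdc : Tendsto (fun N : ℕ => (d N : ℝ) / N) atTop (nhds c)) (hc : 1 < c)
    {U : ∀ N, Matrix (Fin (d N)) (Fin r) ℝ} (hU : ∀ᶠ N in atTop, (U N)ᵀ * U N = 1)
    {V : ∀ N, Matrix (Fin N) (Fin r) ℝ} (hV : ∀ᶠ N in atTop, (V N)ᵀ * V N = 1) :
    Tendsto (fun p : Σ N, Matrix (Fin (d N)) (Fin N) ℝ => (V p.1)ᵀ * pinv p.2 * U p.1)
      (inProb (gaussLaw η d)) (nhds 0) := by
  refine tendsto_pi_nhds.mpr fun i => tendsto_pi_nhds.mpr fun j => ?_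
  have hs : ∀ k : Fin r, (Pi.single k 1 : Fin r → ℝ) ⬝ᵥ Pi.single k 1 = 1 := fun k => by simp
  refine (tendsto_pinv_form hη hd hdc hc (eventually_mulVec_unit hV (hs i))
    (eventually_mulVec_unit hU (hs j))).congr fun p => ?_
  rw [mulVec_dotProduct, Matrix.mulVec_mulVec, Matrix.mulVec_mulVec]
  simp

/-- Convergence in probability of `K₁⁻¹`. -/
lemma tendsto_K1mat_inv (hη : 0 < η) (hd : ∀ N, 0 < d N)
    (hdc : Tendsto (fun N : ℕ => (d N : ℝ) / N) atTop (nhds c)) (hc : 1 < c)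
    {U : ∀ N, Matrix (Fin (d N)) (Fin r) ℝ} (hU : ∀ᶠ N in atTop, (U N)ᵀ * U N = 1)
    {V : ∀ N, Matrix (Fin N) (Fin r) ℝ} (hV : ∀ᶠ N in atTop, (V N)ᵀ * V N = 1)
    {σ : Fin r → ℝ} (hσ : ∀ i, 0 < σ i) :
    Tendsto (fun p : Σ N, Matrix (Fin (d N)) (Fin N) ℝ =>
        (K1mat p.2 (U p.1) (V p.1) (diagonal σ))⁻¹)
      (inProb (gaussLaw η d))
      (nhds ((η ^ 2 * (1 - 1 / c)) •
        ((η ^ 2) • ((diagonal σ)⁻¹ * (diagonal σ)⁻¹) + (1 : Matrix (Fin r) (Fin r) ℝ))⁻¹)) := by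
  have hc0 : 0 < 1 - 1 / c := by
    rw [sub_pos, div_lt_one (by positivity)]; exact hc
  set q : ℝ := 1 - 1 / c with hq
  have hinv : (diagonal σ)⁻¹ = diagonal fun i => (σ i)⁻¹ := by
    refine Matrix.inv_eq_left_inv ?_
    rw [Matrix.diagonal_mul_diagonal, ← Matrix.diagonal_one]
    congr 1
    ext i
    exact inv_mul_cancel₀ (hσ i).ne'
  have hPlim : Tendsto (fun p : Σ N, Matrix (Fin (d N)) (Fin N) ℝ =>
      (Pmat p.2 (U p.1) (diagonal σ))ᵀ * Pmat p.2 (U p.1) (diagonal σ))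
      (inProb (gaussLaw η d)) (nhds (diagonal fun i => q * σ i ^ 2)) := by
    have h := ((tendsto_const_nhds (x := (diagonal σ)ᵀ)).mul
      ((tendsto_const_nhds (x := (1 : Matrix (Fin r) (Fin r) ℝ))).sub
        (tendsto_proj_compression hη hd hdc hc hU))).mul (tendsto_const_nhds (x := diagonal σ))
    have hval : (diagonal σ)ᵀ * ((1 : Matrix (Fin r) (Fin r) ℝ) - (1 / c) • 1) * diagonal σ
        = diagonal fun i => q * σ i ^ 2 := by
      have h1 : (1 : Matrix (Fin r) (Fin r) ℝ) - (1 / c) • 1 = q • 1 := by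
        rw [hq, sub_smul, one_smul]
      rw [h1, Matrix.diagonal_transpose, Matrix.mul_smul, Matrix.mul_one, Matrix.smul_mul,
        Matrix.diagonal_mul_diagonal, ← Matrix.diagonal_smul]
      congr 1
      ext i
      simp [pow_two]
    rw [hval] at h
    refine h.congr' ?_
    filter_upwards [tendsto_fst_inProb.eventually hU] with p hp
    exact (Pmat_gram p.2 hp _).symm
  have hPinv := tendsto_matrix_inv hPlim (by
    rw [Matrix.det_diagonal, isUnit_iff_ne_zero]
    exact Finset.prod_ne_zero_iff.mpr fun i _ =>
      mul_ne_zero hc0.ne' (pow_ne_zero 2 (hσ i).ne'))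
  have hZlim : Tendsto (fun p : Σ N, Matrix (Fin (d N)) (Fin N) ℝ =>
      Zmat p.2 (U p.1) (V p.1) (diagonal σ)) (inProb (gaussLaw η d)) (nhds 1) := by
    have h := (tendsto_const_nhds (x := (1 : Matrix (Fin r) (Fin r) ℝ))).add
      ((tendsto_pinv_compression hη hd hdc hc hU hV).mul (tendsto_const_nhds (x := diagonal σ)))
    rw [zero_mul, add_zero] at h
    exact h
  have hZT := ((continuous_id (X := Matrix (Fin r) (Fin r) ℝ)).matrix_transpose.tendsto 1).comp hZlim
  have hK := (tendsto_Hmat_gram hη hd hdc hc hV).add ((hZlim.mul hPinv).mul hZT)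
  set W : Matrix (Fin r) (Fin r) ℝ := (η ^ 2) • ((diagonal σ)⁻¹ * (diagonal σ)⁻¹) + 1 with hWdef
  have hW : W = diagonal fun i => η ^ 2 * ((σ i)⁻¹ * (σ i)⁻¹) + 1 := by
    rw [hWdef, hinv, Matrix.diagonal_mul_diagonal, ← Matrix.diagonal_smul, ← Matrix.diagonal_one,
      Matrix.diagonal_add]
    rfl
  have hWdet : IsUnit W.det := by
    rw [hW, Matrix.det_diagonal, isUnit_iff_ne_zero]
    refine Finset.prod_ne_zero_iff.mpr fun i _ => ?_
    have := mul_self_nonneg (σ i)⁻¹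
    positivity
  have hLval : (η ^ 2 * q)⁻¹ • (1 : Matrix (Fin r) (Fin r) ℝ) +
      1 * (diagonal fun i => q * σ i ^ 2)⁻¹ * (id 1)ᵀ = (η ^ 2 * q)⁻¹ • W := by
    have h2 : (diagonal fun i => q * σ i ^ 2)⁻¹ = diagonal fun i => (q * σ i ^ 2)⁻¹ := by
      refine Matrix.inv_eq_left_inv ?_
      rw [Matrix.diagonal_mul_diagonal, ← Matrix.diagonal_one]
      congr 1
      ext i
      exact inv_mul_cancel₀ (mul_ne_zero hc0.ne' (pow_ne_zero 2 (hσ i).ne'))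
    rw [h2, id, Matrix.transpose_one, one_mul, mul_one, hW, ← Matrix.diagonal_smul,
      ← Matrix.diagonal_one, ← Matrix.diagonal_smul, Matrix.diagonal_add]
    congr 1
    ext i
    have := hσ i
    simp only [Pi.smul_apply, smul_eq_mul]
    field_simp
    ring
  have hg : η ^ 2 * q ≠ 0 := by positivity
  have hLinv : ((η ^ 2 * q)⁻¹ • W)⁻¹ = (η ^ 2 * q) • W⁻¹ := by
    refine Matrix.inv_eq_right_inv ?_
    rw [Matrix.smul_mul, Matrix.mul_smul, smul_smul, inv_mul_cancel₀ hg, one_smul,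
      Matrix.mul_nonsing_inv _ hWdet]
  rw [hLval] at hK
  rw [← hLinv]
  refine tendsto_matrix_inv hK ?_
  rw [Matrix.det_smul, isUnit_iff_ne_zero]
  exact mul_ne_zero (pow_ne_zero _ (inv_ne_zero hg)) hWdet.ne_zero

end Assembly

/-- **Lemma (limit of `E[K₁⁻¹]`, `c > 1`).**
Fix `c > 1`, `η > 0`, `r`, and an invertible diagonal `r × r` matrix `Σ = S` with positive
diagonal entries.  For each `N`, let `d = d(N)` satisfy `d(N)/N → c`, let `A_N` be a `d × N`
random matrix with i.i.d. Gaussian entries of mean `0` and variance `η²/d`, let `U_N` be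
`d × r` with `U_Nᵀ U_N = I_r` and `V_N` be `N × r` with `V_Nᵀ V_N = I_r`.  With
`H_N = V_Nᵀ A_N†`, `Z_N = I + V_Nᵀ A_N† U_N S`, `P_N = -(I - A_N A_N†) U_N S`, and
`K₁ = H_N H_Nᵀ + Z_N (P_Nᵀ P_N)⁻¹ Z_Nᵀ`, one has, entrywise,
`E[K₁⁻¹] → η² (1 - 1/c) (η² S⁻² + I_r)⁻¹` as `N → ∞`. -/
theorem stmt_14 (c η : ℝ) (hc : 1 < c) (hη : 0 < η) (r : ℕ) (hr : 0 < r)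
    (S : Matrix (Fin r) (Fin r) ℝ) (σ : Fin r → ℝ) (hσ : ∀ i, 0 < σ i)
    (hSdiag : S = Matrix.diagonal σ)
    (d : ℕ → ℕ) (hd : ∀ N, 0 < d N)
    (hdc : Tendsto (fun N : ℕ => (d N : ℝ) / N) atTop (nhds c))
    (U : (N : ℕ) → Matrix (Fin (d N)) (Fin r) ℝ)
    (hU : ∀ N, r ≤ d N → (U N)ᵀ * U N = 1)
    (V : (N : ℕ) → Matrix (Fin N) (Fin r) ℝ)
    (hV : ∀ N, r ≤ N → (V N)ᵀ * V N = 1)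
    (i j : Fin r) :
    Tendsto
      (fun N : ℕ => ∫ A, (K1mat A (U N) (V N) S)⁻¹ i j
          ∂(gaussMatrix (d N) N ((η ^ 2 / (d N : ℝ)).toNNReal)))
      atTop
      (nhds (((η ^ 2 * (1 - 1 / c)) •
        ((η ^ 2) • (S⁻¹ * S⁻¹) + (1 : Matrix (Fin r) (Fin r) ℝ))⁻¹) i j)) := by
  subst hSdiag
  have hU' : ∀ᶠ N in atTop, (U N)ᵀ * U N = 1 := by
    filter_upwards [eventually_lt_dim hdc hc, eventually_ge_atTop r] with N hN hNr
    exact hU N (hNr.trans hN.le)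
  have hV' : ∀ᶠ N in atTop, (V N)ᵀ * V N = 1 := by
    filter_upwards [eventually_ge_atTop r] with N hNr
    exact hV N hNr
  refine tendsto_integral_of_tendsto_inProb (μ := gaussLaw η d)
    (C := 2 * (2 * (gaussSqVar * η ^ 4) + 2 * η ^ 4))
    (fun N => measurable_K1mat_inv (U N) (V N) _ i j)
    (((continuous_apply_apply i j).tendsto _).comp
      (tendsto_K1mat_inv hη hd hdc hc hU' hV' hσ)) ?_
  filter_upwards [hV', eventually_lt_dim hdc hc] with N hVN hN
  exact lintegral_K1mat_inv_sq_le hη (hd N) hN.le (U N) hVN _ i j
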